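/- arXiv:1807.01758 — 2 statements merged into one kernel-verified Lean document; each statement's English description precedes it below -/
import Mathlib

section
/- (Expected number of upcrossing times in a unit interval.) Let $(B_t)_{t\ge 0}$ be a standard one-dimensional Brownian motion started at $0$. Fix $\gamma\in(0,1)$ and $\eta>0$ with $2\eta>\gamma$, and $A\ge \gamma+\eta+2$. Define recursively $R_0:=0$ and for $k\ge 1$: $T_k:=\inf\{t\ge R_{k-1}: B_t=(\gamma+\eta)t+A\}$ and $R_k:=\inf\{t\ge T_k: B_t=\gamma t\}$. Then for every integer $n\ge 1$, $\mathbb{E}\big[\#\{i\ge 1: T_i\in(n-1,n]\}\big]\le \frac{4}{\sqrt{2\pi n}\,(\gamma+\eta)}\,e^{-\frac{(\gamma+\eta)^2 n}{2}}$. -/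
open MeasureTheory ProbabilityTheory Filter Real
open scoped ENNReal Classical

noncomputable section

/-- A standard one-dimensional Brownian motion started at `w`: a.s.-everywhere continuous
sample paths, `B 0 = w`, all finite linear combinations of (recentered) marginals at
nonnegative times are centered Gaussian, and covariance `𝔼[(B_s - w)(B_t - w)] = s ∧ t`. -/
structure IsBMFrom (Ω : Type) [MeasurableSpace Ω] (P : Measure Ω)
    (B : ℝ → Ω → ℝ) (w : ℝ) : Prop where
  meas : ∀ t, Measurable (B t)
  cont : ∀ ω, Continuous fun t => B t ω
  start : ∀ ω, B 0 ω = w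
  gaussian : ∀ (n : ℕ) (c : Fin n → ℝ) (t : Fin n → ℝ), (∀ i, 0 ≤ t i) →
    ∃ v : NNReal,
      Measure.map (fun ω => ∑ i, c i * (B (t i) ω - w)) P = gaussianReal 0 v
  cov : ∀ s t : ℝ, 0 ≤ s → 0 ≤ t →
    (∫ ω, (B s ω - w) * (B t ω - w) ∂P) = min s t

/-- First time `s ≥ τ(ω)` (with `s ≥ 0`) at which the path `s ↦ f s ω` satisfies the
condition `pred s (f s ω)`, with values in `ℝ≥0∞` and the convention `inf ∅ = ∞`. -/
def hitTimeFrom {Ω : Type} (f : ℝ → Ω → ℝ) (pred : ℝ → ℝ → Prop)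
    (τ : Ω → ℝ≥0∞) (ω : Ω) : ℝ≥0∞ :=
  sInf {u : ℝ≥0∞ | ∃ s : ℝ, 0 ≤ s ∧ u = ENNReal.ofReal s ∧
    τ ω ≤ ENNReal.ofReal s ∧ pred s (f s ω)}

/-- The alternating sequence of stopping times `(R_k, T_k)` for the path `B`:
`R_0 = 0`, `T_k = inf{t ≥ R_{k-1} : B_t = (γ+η)t + A}` and
`R_k = inf{t ≥ T_k : B_t = γ t}`. The first component of `upTimes B γ η A k` is `R_k` and
the second component of `upTimes B γ η A (k+1)` is `T_{k+1}` (at `k = 0` the second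
component is a dummy value). -/
def upTimes {Ω : Type} (B : ℝ → Ω → ℝ) (γ η A : ℝ) : ℕ → ((Ω → ℝ≥0∞) × (Ω → ℝ≥0∞))
  | 0 => (fun _ => 0, fun _ => 0)
  | k + 1 =>
      let R := (upTimes B γ η A k).1
      let T := hitTimeFrom B (fun s v => v = (γ + η) * s + A) R
      (hitTimeFrom B (fun s v => v = γ * s) T, T)

open scoped NNReal Topology

/-- A Brownian motion started at `0`, restricted to nonnegative times, is a pre-Brownian motion. -/
lemma IsBMFrom.isPreBrownianReal {Ω : Type} [MeasurableSpace Ω] {P : Measure Ω}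
    {B : ℝ → Ω → ℝ} (hB : IsBMFrom Ω P B 0) :
    IsPreBrownianReal (fun t : ℝ≥0 => B t) P := by
  have hlin (n : ℕ) (c t : Fin n → ℝ) (ht : ∀ i, 0 ≤ t i) :
      ∃ v : ℝ≥0, Measure.map (fun ω => ∑ i, c i * B (t i) ω) P = gaussianReal 0 v := by
    simpa using hB.gaussian n c t ht
  have hgauss : IsGaussianProcess (fun t : ℝ≥0 => B t) P := by
    refine ⟨fun I => ⟨isGaussian_of_map_eq_gaussianReal fun L => ?_⟩⟩
    let e := I.equivFin
    obtain ⟨v, hv⟩ := hlin I.card (fun i => L (Pi.single (e.symm i) 1))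
      (fun i => ((e.symm i : ℝ≥0) : ℝ)) (fun i => NNReal.coe_nonneg _)
    refine ⟨0, v, ?_⟩
    have hm : Measurable fun ω => I.restrict fun t : ℝ≥0 => B t ω :=
      measurable_pi_lambda _ fun i => hB.meas _
    rw [Measure.map_map (by fun_prop) hm, ← hv]
    congr 1
    ext ω
    rw [Function.comp_apply, ← L.sum_comp_single,
      ← e.symm.sum_comp]
    refine Finset.sum_congr rfl fun i _ => ?_
    have : (Pi.single (e.symm i) (B ((e.symm i : ℝ≥0) : ℝ) ω) : I → ℝ)
        = B ((e.symm i : ℝ≥0) : ℝ) ω • Pi.single (e.symm i) 1 := by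
      rw [← Pi.single_smul]; simp
    simp [this, mul_comm]
  have hmean (t : ℝ≥0) : ∫ ω, B t ω ∂P = 0 := by
    obtain ⟨v, hv⟩ := hlin 1 (fun _ => 1) (fun _ => t) fun _ => t.2
    simp only [Finset.univ_unique, Finset.sum_singleton, one_mul] at hv
    rw [← integral_id_gaussianReal (μ := 0) (v := v), ← hv,
      integral_map (hB.meas _).aemeasurable (by fun_prop)]
  refine hgauss.isPreBrownianReal_of_covariance hmean fun s t hst => ?_
  have := hB.cov s t s.2 t.2
  simp only [sub_zero] at this
  rw [covariance, hmean, hmean]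
  simpa [hst] using this

/-- A pre-Brownian motion sampled along a monotone sequence of times is a martingale. -/
lemma IsPreBrownianReal.exists_martingale_comp {Ω : Type*} [MeasurableSpace Ω] {P : Measure Ω}
    {W : ℝ≥0 → Ω → ℝ} (hW : IsPreBrownianReal W P) (hm : ∀ t, Measurable (W t))
    {t : ℕ → ℝ≥0} (ht : Monotone t) :
    ∃ 𝒢 : Filtration ℕ ‹MeasurableSpace Ω›, Martingale (fun k => W (t k)) 𝒢 P := by
  have : IsProbabilityMeasure P := hW.isGaussianProcess.isProbabilityMeasure
  let ℱ := Filtration.natural W fun i => (hm i).stronglyMeasurable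
  have hℱ : StronglyAdapted ℱ W := Filtration.stronglyAdapted_natural _
  let 𝒢 : Filtration ℕ ‹MeasurableSpace Ω› :=
    ⟨fun k => ℱ (t k), fun i j hij => ℱ.mono (ht hij), fun k => ℱ.le _⟩
  refine ⟨𝒢, martingale_nat (fun k => hℱ (t k)) (fun k => hW.integrable_eval _) fun k => ?_⟩
  obtain ⟨d, hd⟩ : ∃ d, t (k + 1) = t k + d := exists_add_of_le (ht k.le_succ)
  have hincr : P[W (t (k + 1)) - W (t k) | 𝒢 k] =ᵐ[P] fun _ => 0 := by
    have hind := (hW.indepFun_shift (t k)).comp (measurable_pi_apply d) measurable_id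
    have hmeas : Measurable (W (t (k + 1)) - W (t k)) := (hm _).sub (hm _)
    have h := condExp_indep_eq (μ := P)
      (m₁ := MeasurableSpace.comap (W (t (k + 1)) - W (t k)) inferInstance)
      (m₂ := 𝒢 k) (f := W (t (k + 1)) - W (t k)) hmeas.comap_le (𝒢.le k)
      (Measurable.stronglyMeasurable (comap_measurable _)) ?_
    · refine h.trans (.of_forall fun ω => ?_)
      simp only [Pi.sub_apply]
      rw [integral_sub (hW.integrable_eval _) (hW.integrable_eval _), hW.integral_eval,
        hW.integral_eval, sub_zero]
    · have h𝒢 : 𝒢 k = MeasurableSpace.comap (fun ω (j : Set.Iic (t k)) => W j ω) inferInstance :=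
        
        Filtration.natural_eq_comap W (fun i => (hm i).stronglyMeasurable) (t k)
      rw [h𝒢, hd]
      exact hind
  have hsplit : W (t (k + 1)) = (W (t (k + 1)) - W (t k)) + W (t k) := by simp
  have hself : P[W (t k) | 𝒢 k] = W (t k) :=
    condExp_of_stronglyMeasurable (𝒢.le k) (hℱ (t k)) (hW.integrable_eval _)
  have hadd := condExp_add (μ := P) (f := W (t (k + 1)) - W (t k)) (g := W (t k))
    ((hW.integrable_eval _).sub (hW.integrable_eval _)) (hW.integrable_eval _) (𝒢 k)
  rw [← hsplit, hself] at hadd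
  filter_upwards [hadd, hincr] with ω h1 h2
  simp [h1, h2]

/-- Doob's upcrossing inequality, keeping the contribution of the initial value. -/
lemma mul_integral_upcrossingsBefore_le_sub {Ω : Type*} {m0 : MeasurableSpace Ω} {μ : Measure Ω}
    [IsFiniteMeasure μ] {𝒢 : Filtration ℕ m0} {f : ℕ → Ω → ℝ} (hf : Submartingale f 𝒢 μ)
    {a b : ℝ} (hab : a < b) (N : ℕ) :
    (b - a) * ∫ ω, (upcrossingsBefore a b f N ω : ℝ) ∂μ
      ≤ ∫ ω, (f N ω - a)⁺ ∂μ - ∫ ω, (f 0 ω - a)⁺ ∂μ := by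
  have hg : Submartingale (fun k ω => (f k ω - a)⁺) 𝒢 μ :=
    (hf.sub_martingale (martingale_const 𝒢 μ a)).pos
  have hba : 0 < b - a := sub_pos.2 hab
  calc (b - a) * ∫ ω, (upcrossingsBefore a b f N ω : ℝ) ∂μ
      = ∫ ω, (b - a) * (upcrossingsBefore 0 (b - a) (fun k ω => (f k ω - a)⁺) N ω : ℝ) ∂μ := by
        simp_rw [upcrossingsBefore_pos_eq hab, integral_const_mul]
    _ ≤ μ[∑ k ∈ Finset.range N, upcrossingStrat 0 (b - a) (fun k ω => (f k ω - a)⁺) N k *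
          ((fun k ω => (f k ω - a)⁺) (k + 1) - (fun k ω => (f k ω - a)⁺) k)] := by
        refine integral_mono_of_nonneg (.of_forall fun ω => by positivity)
          ((hg.sum_upcrossingStrat_mul 0 (b - a) N).integrable N) (.of_forall fun ω => ?_)
        simpa using mul_upcrossingsBefore_le (f := fun k ω => (f k ω - a)⁺) (N := N) (ω := ω)
          (posPart_nonneg _) hba
    _ ≤ _ := hg.sum_mul_upcrossingStrat_le

lemma le_hitTimeFrom {Ω : Type} (f : ℝ → Ω → ℝ) (pred : ℝ → ℝ → Prop) (τ : Ω → ℝ≥0∞) (ω : Ω) :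
    τ ω ≤ hitTimeFrom f pred τ ω := by
  refine le_sInf ?_
  rintro _ ⟨s, -, rfl, h, -⟩
  exact h

/-- A finite hitting time of a closed condition is attained. -/
lemma hitTimeFrom_spec {Ω : Type} {f : ℝ → Ω → ℝ} {pred : ℝ → ℝ → Prop} {τ : Ω → ℝ≥0∞} {ω : Ω}
    (hclosed : IsClosed {s | pred s (f s ω)}) (hfin : hitTimeFrom f pred τ ω ≠ ∞) :
    pred (hitTimeFrom f pred τ ω).toReal (f (hitTimeFrom f pred τ ω).toReal ω) := by
  set S : Set ℝ≥0∞ := {u : ℝ≥0∞ | ∃ s : ℝ, 0 ≤ s ∧ u = ENNReal.ofReal s ∧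
    τ ω ≤ ENNReal.ofReal s ∧ pred s (f s ω)} with hS
  change pred (sInf S).toReal (f (sInf S).toReal ω)
  have hne : S.Nonempty := by
    by_contra hempty
    rw [Set.not_nonempty_iff_eq_empty] at hempty
    exact hfin (by change sInf S = ∞; simp [hempty])
  obtain ⟨u, -, hu, huS⟩ := exists_seq_tendsto_sInf hne (OrderBot.bddBelow S)
  refine hclosed.mem_of_tendsto ((ENNReal.tendsto_toReal hfin).comp hu) (.of_forall fun k => ?_)
  obtain ⟨s, hs, hus, -, hp⟩ := huS k
  simpa [hus, ENNReal.toReal_ofReal hs] using hp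

section upTimes

variable {Ω : Type} {B : ℝ → Ω → ℝ} {γ η A : ℝ} {ω : Ω}

lemma upTimes_fst_le_snd_succ (i : ℕ) :
    (upTimes B γ η A i).1 ω ≤ (upTimes B γ η A (i + 1)).2 ω :=
  le_hitTimeFrom B (fun s v => v = (γ + η) * s + A) _ ω

lemma upTimes_snd_le_fst (i : ℕ) :
    (upTimes B γ η A (i + 1)).2 ω ≤ (upTimes B γ η A (i + 1)).1 ω :=
  le_hitTimeFrom B (fun s v => v = γ * s) _ ω

lemma upTimes_fst_le_snd {i j : ℕ} (hij : i < j) :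
    (upTimes B γ η A (i + 1)).1 ω ≤ (upTimes B γ η A (j + 1)).2 ω := by
  have hmono : Monotone fun k => (upTimes B γ η A k).1 ω :=
    monotone_nat_of_le_succ fun k =>
      (upTimes_fst_le_snd_succ k).trans (upTimes_snd_le_fst k)
  exact (hmono hij).trans (upTimes_fst_le_snd_succ j)

lemma apply_upTimes_snd (hcont : Continuous fun t => B t ω) {i : ℕ}
    (hfin : (upTimes B γ η A (i + 1)).2 ω ≠ ∞) :
    B ((upTimes B γ η A (i + 1)).2 ω).toReal ω
      = (γ + η) * ((upTimes B γ η A (i + 1)).2 ω).toReal + A :=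
  hitTimeFrom_spec (pred := fun s v => v = (γ + η) * s + A)
    (isClosed_eq hcont (by fun_prop)) hfin

lemma apply_upTimes_fst (hcont : Continuous fun t => B t ω) {i : ℕ}
    (hfin : (upTimes B γ η A (i + 1)).1 ω ≠ ∞) :
    B ((upTimes B γ η A (i + 1)).1 ω).toReal ω
      = γ * ((upTimes B γ η A (i + 1)).1 ω).toReal :=
  hitTimeFrom_spec (pred := fun s v => v = γ * s) (isClosed_eq hcont (by fun_prop)) hfin

end upTimes

/-- The `k`-th point of the grid of mesh `1 / M` on `[s, s + 1]`, constant equal to `s + 1` past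
the right end point. -/
def unitGrid (s : ℝ) (M k : ℕ) : ℝ := min (s + k / M) (s + 1)

lemma monotone_unitGrid (s : ℝ) (M : ℕ) : Monotone (unitGrid s M) := fun i j hij => by
  unfold unitGrid
  gcongr

lemma unitGrid_zero (s : ℝ) (M : ℕ) : unitGrid s M 0 = s := by simp [unitGrid]

lemma unitGrid_of_le {s : ℝ} {M k : ℕ} (hM : 0 < M) (hk : M ≤ k) : unitGrid s M k = s + 1 := by
  have : (1 : ℝ) ≤ k / M := by
    rw [one_le_div (by positivity)]
    exact_mod_cast hk
  simp [unitGrid, this]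

lemma tendsto_unitGrid_ceil {s t : ℝ} (hst : s ≤ t) (hts : t ≤ s + 1) :
    Tendsto (fun M : ℕ => unitGrid s M ⌈(M : ℝ) * (t - s)⌉₊) atTop (𝓝 t) := by
  have hlim : Tendsto (fun M : ℕ => t + 1 / (M : ℝ)) atTop (𝓝 t) := by
    simpa using (tendsto_const_nhds (x := t)).add (tendsto_one_div_atTop_nhds_zero_nat (𝕜 := ℝ))
  refine tendsto_of_tendsto_of_tendsto_of_le_of_le' tendsto_const_nhds hlim ?_ ?_ <;>
    filter_upwards [eventually_gt_atTop 0] with M hM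
  all_goals have hM' : (0 : ℝ) < M := by exact_mod_cast hM
  · refine le_min ?_ hts
    have : t - s ≤ (⌈(M : ℝ) * (t - s)⌉₊ : ℝ) / M := by
      rw [le_div_iff₀ hM', mul_comm]
      exact Nat.le_ceil _
    linarith
  · refine (min_le_left _ _).trans ?_
    have : (⌈(M : ℝ) * (t - s)⌉₊ : ℝ) / M ≤ t - s + 1 / M := by
      rw [div_le_iff₀ hM', add_mul, one_div_mul_cancel hM'.ne', mul_comm]
      exact (Nat.ceil_lt_add_one (mul_nonneg (sub_nonneg.2 hst) hM'.le)).le.trans (by linarith)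
    linarith

lemma eventually_ceil_lt_ceil {s t r : ℝ} (hst : s ≤ t) (htr : t < r) :
    ∀ᶠ M : ℕ in atTop, ⌈(M : ℝ) * (t - s)⌉₊ < ⌈(M : ℝ) * (r - s)⌉₊ := by
  have h : Tendsto (fun M : ℕ => (M : ℝ) * (r - t)) atTop atTop :=
    tendsto_natCast_atTop_atTop.atTop_mul_const (sub_pos.2 htr)
  filter_upwards [h.eventually_ge_atTop 1] with M hM
  rw [Nat.lt_ceil]
  have := Nat.ceil_lt_add_one (mul_nonneg (Nat.cast_nonneg M) (sub_nonneg.2 hst))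
  linarith

/-- On a fine enough grid the sampled path completes as many upcrossings of `[a, b]` as there are
prescribed times at which the path is above `b`, provided that it goes below `a` in between; the
first of these times is lost only if the path does not start below `a`. -/
lemma eventually_card_le_upcrossingsBefore {Ω : Type*} {B : ℝ → Ω → ℝ} {ω : Ω}
    (hcont : Continuous fun t => B t ω) {a b s : ℝ} (hab : a < b) (τ : ℕ → ℝ) (F : Finset ℕ)
    (hmem : ∀ i ∈ F, τ i ∈ Set.Icc s (s + 1)) (habove : ∀ i ∈ F, b < B (τ i) ω)
    (hbelow : ∀ i ∈ F, ∀ j ∈ F, i < j → ∃ r ∈ Set.Icc (τ i) (τ j), B r ω < a) :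
    ∀ᶠ M : ℕ in atTop, F.card ≤ (if a ≤ B s ω then 1 else 0)
      + upcrossingsBefore a b (fun k => B (unitGrid s M k)) (M + 1) ω := by
  have hgrid {t : ℝ} (ht : t ∈ Set.Icc s (s + 1)) :
      Tendsto (fun M : ℕ => B (unitGrid s M ⌈(M : ℝ) * (t - s)⌉₊) ω) atTop (𝓝 (B t ω)) :=
    (hcont.tendsto t).comp (tendsto_unitGrid_ceil ht.1 ht.2)
  have hceil {t u : ℝ} (h : t ≤ u) (M : ℕ) : ⌈(M : ℝ) * (t - s)⌉₊ ≤ ⌈(M : ℝ) * (u - s)⌉₊ := by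
    gcongr
  have key : ∀ F' : Finset ℕ, F' ⊆ F → ∀ i ∈ F', (∀ j ∈ F', j ≤ i) →
      ∀ᶠ M : ℕ in atTop, F'.card ≤ (if a ≤ B s ω then 1 else 0)
        + upcrossingsBefore a b (fun k => B (unitGrid s M k)) (⌈(M : ℝ) * (τ i - s)⌉₊ + 1) ω := by
    intro F'
    induction F' using Finset.induction_on_max with
    | empty => simp
    | insert j F' hj ih =>
      intro hsub i hi hmax
      have hij : i = j := by
        refine (Finset.mem_insert.1 hi).resolve_right fun h => ?_
        exact (hj i h).not_ge (hmax j (Finset.mem_insert_self _ _))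
      subst hij
      have hiF : i ∈ F := hsub hi
      have hnot : i ∉ F' := fun h => (hj i h).false
      have htop := (hgrid (hmem i hiF)).eventually_const_lt (habove i hiF)
      rw [Finset.card_insert_of_notMem hnot]
      rcases F'.eq_empty_or_nonempty with rfl | hne
      · by_cases ha : a ≤ B s ω
        · simp [ha]
        · filter_upwards [htop] with M hM
          have := upcrossingsBefore_lt_of_exists_upcrossing (N := 0) (ω := ω) hab le_rfl
            (f := fun k => B (unitGrid s M k)) (by simpa [unitGrid_zero] using ha)
            (zero_le (a := ⌈(M : ℝ) * (τ i - s)⌉₊)) hM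
          simp only [Finset.card_empty]
          omega
      · have hp := F'.max'_mem hne
        set p := F'.max' hne
        have hpF : p ∈ F := hsub (Finset.mem_insert_of_mem hp)
        obtain ⟨r, hr, hra⟩ := hbelow p hpF i hiF (hj p hp)
        have hpr : τ p < r := lt_of_le_of_ne hr.1 fun h => by
          have := habove p hpF
          rw [h] at this
          linarith
        have hrI : r ∈ Set.Icc s (s + 1) :=
          ⟨(hmem p hpF).1.trans hr.1, hr.2.trans (hmem i hiF).2⟩
        filter_upwards [htop, (hgrid hrI).eventually_lt_const hra,
          eventually_ceil_lt_ceil (hmem p hpF).1 hpr,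
          ih ((Finset.subset_insert _ _).trans hsub) p hp fun j hj' => F'.le_max' j hj']
          with M hM1 hM2 hM3 hM4
        have := upcrossingsBefore_lt_of_exists_upcrossing (ω := ω) hab
          (N := ⌈(M : ℝ) * (τ p - s)⌉₊ + 1) (f := fun k => B (unitGrid s M k))
          hM3 hM2 (hceil hr.2 M) hM1
        omega
  rcases F.eq_empty_or_nonempty with rfl | hne
  · simp
  filter_upwards [key F subset_rfl _ (F.max'_mem hne) fun j hj => F.le_max' j hj] with M hM
  refine hM.trans (add_le_add_right (upcrossingsBefore_mono hab ?_ ω) _)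
  have hmax := (hmem _ (F.max'_mem hne)).2
  have hle : ⌈(M : ℝ) * (τ (F.max' hne) - s)⌉₊ ≤ M :=
    Nat.ceil_le.2 (mul_le_of_le_one_right (Nat.cast_nonneg M) (by linarith))
  omega

/-- The truncated first moment of a centered Gaussian. -/
lemma integral_Ici_gaussianReal {v : ℝ≥0} (hv : v ≠ 0) (c : ℝ) :
    ∫ x, (Set.Ici c).indicator id x ∂gaussianReal 0 v
      = v * ((√(2 * π * v))⁻¹ * exp (-c ^ 2 / (2 * v))) := by
  have hv' : (0 : ℝ) < v := by positivity
  set F : ℝ → ℝ := fun x => -(v * ((√(2 * π * v))⁻¹ * exp (-x ^ 2 / (2 * v)))) with hF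
  have hderiv (x : ℝ) : HasDerivAt F (gaussianPDFReal 0 v x * x) x := by
    have h1 : HasDerivAt (fun x : ℝ => -x ^ 2 / (2 * v)) (-(2 * x) / (2 * v)) x := by
      simpa using ((hasDerivAt_pow 2 x).neg.div_const (2 * (v : ℝ)))
    refine ((h1.exp.const_mul (√(2 * π * v))⁻¹).const_mul (v : ℝ)).neg.congr_deriv ?_
    simp only [gaussianPDFReal, sub_zero]
    field_simp
  have hint : Integrable (fun x => gaussianPDFReal 0 v x * x) volume := by
    have h : Integrable id (gaussianReal 0 v) := (memLp_id_gaussianReal 1).integrable le_rfl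
    rw [gaussianReal_of_var_ne_zero _ hv, integrable_withDensity_iff_integrable_smul'
      (measurable_gaussianPDF 0 v) (.of_forall fun x => gaussianPDF_lt_top)] at h
    simpa [gaussianPDF, ENNReal.toReal_ofReal (gaussianPDFReal_nonneg 0 v _)] using h
  have hlim : Tendsto F atTop (𝓝 0) := by
    have h : Tendsto (fun x : ℝ => -x ^ 2 / (2 * v)) atTop atBot :=
      (tendsto_neg_atTop_atBot.comp (tendsto_pow_atTop two_ne_zero)).atBot_div_const
        (by positivity)
    simpa [hF] using (((tendsto_exp_atBot.comp h).const_mul (√(2 * π * v))⁻¹).const_mul (v : ℝ)).neg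
  rw [integral_gaussianReal_eq_integral_smul hv]
  have hind (x : ℝ) : gaussianPDFReal 0 v x • (Set.Ici c).indicator id x
      = (Set.Ici c).indicator (fun x => gaussianPDFReal 0 v x * x) x := by
    by_cases hx : x ∈ Set.Ici c <;> simp [hx]
  simp_rw [hind]
  rw [integral_indicator measurableSet_Ici, integral_Ici_eq_integral_Ioi,
    integral_Ioi_of_hasDerivAt_of_tendsto' (fun x _ => hderiv x) hint.integrableOn hlim]
  simp [hF]

lemma indicator_add_posPart_sub_le {c r x : ℝ} (hc : 0 < c) (hr0 : 0 ≤ r) (hr1 : r ≤ 1) :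
    (Set.Ici c).indicator 1 (r * x) + ((x - c)⁺ - (r * x - c)⁺)
      ≤ (c⁻¹ + (1 - r)) * (Set.Ici c).indicator id x := by
  by_cases hx : c ≤ x
  · have h1 : 1 ≤ c⁻¹ * x := by rwa [inv_mul_eq_div, one_le_div hc]
    have h2 : 0 ≤ (1 - r) * (x - c) := mul_nonneg (by linarith) (by linarith)
    rw [posPart_eq_self.2 (sub_nonneg.2 hx)]
    by_cases hrx : c ≤ r * x
    · rw [posPart_eq_self.2 (sub_nonneg.2 hrx)]
      simp [hx, hrx]
      linarith
    · rw [posPart_eq_zero.2 (by linarith : r * x - c ≤ 0)]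
      simp [hx, hrx]
      nlinarith
  · have hrx : r * x < c := by
      rcases le_total 0 x with h | h <;> nlinarith
    rw [posPart_eq_zero.2 (by linarith : r * x - c ≤ 0), posPart_eq_zero.2 (by linarith)]
    simp [hx, hrx.not_ge]

lemma IsBMFrom.exists_martingale_unitGrid {Ω : Type} [MeasurableSpace Ω] {P : Measure Ω}
    {B : ℝ → Ω → ℝ} (hB : IsBMFrom Ω P B 0) {s : ℝ} (hs : 0 ≤ s) (M : ℕ) :
    ∃ 𝒢 : Filtration ℕ ‹MeasurableSpace Ω›, Martingale (fun k => B (unitGrid s M k)) 𝒢 P := by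
  have hcoe (k : ℕ) : ((unitGrid s M k).toNNReal : ℝ) = unitGrid s M k :=
    Real.coe_toNNReal _ (le_min (by positivity) (by positivity))
  simpa only [hcoe] using IsPreBrownianReal.exists_martingale_comp hB.isPreBrownianReal
    (fun t => hB.meas t) (t := fun k => (unitGrid s M k).toNNReal)
    fun _ _ h => Real.toNNReal_mono (monotone_unitGrid s M h)

lemma integrable_posPart_mul_sub_gaussianReal (v : ℝ≥0) (r c : ℝ) :
    Integrable (fun x => (r * x - c)⁺) (gaussianReal 0 v) := by
  have h : Integrable id (gaussianReal 0 v) := (memLp_id_gaussianReal 1).integrable le_rfl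
  exact ((h.const_mul r).sub (integrable_const c)).pos_part

lemma IsBMFrom.lintegral_upcrossingsBefore_le {Ω : Type} [MeasurableSpace Ω] {P : Measure Ω}
    [IsProbabilityMeasure P] {B : ℝ → Ω → ℝ} (hB : IsBMFrom Ω P B 0) {s c : ℝ} (hs : 0 ≤ s)
    (hc : 0 < c) {M : ℕ} (hM : 0 < M) :
    ∫⁻ ω, (((if c ≤ B s ω then 1 else 0)
        + upcrossingsBefore c (c + 1) (fun k => B (unitGrid s M k)) (M + 1) ω : ℕ) : ℝ≥0∞) ∂P
      ≤ ENNReal.ofReal ((c⁻¹ + (s + 1)⁻¹)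
          * ((s + 1) * ((√(2 * π * (s + 1)))⁻¹ * exp (-c ^ 2 / (2 * (s + 1)))))) := by
  obtain ⟨𝒢, hmart⟩ := hB.exists_martingale_unitGrid hs M
  have hcc : c < c + 1 := lt_add_one c
  have hupInt := hmart.1.integrable_upcrossingsBefore (μ := P) (N := M + 1) hcc
  have hup := mul_integral_upcrossingsBefore_le_sub hmart.submartingale hcc (M + 1)
  rw [unitGrid_zero, unitGrid_of_le hM M.le_succ, add_sub_cancel_left, one_mul] at hup
  have hone : Measurable ((Set.Ici c).indicator (1 : ℝ → ℝ)) :=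
    measurable_one.indicator measurableSet_Ici
  have hindInt : Integrable (fun ω => (Set.Ici c).indicator (1 : ℝ → ℝ) (B s ω)) P :=
    Integrable.of_bound (hone.comp (hB.meas s)).aestronglyMeasurable 1 (.of_forall fun ω => by
      by_cases h : c ≤ B s ω <;> simp [h])
  have hcast (ω : Ω) : (((if c ≤ B s ω then 1 else 0)
        + upcrossingsBefore c (c + 1) (fun k => B (unitGrid s M k)) (M + 1) ω : ℕ) : ℝ≥0∞)
      = ENNReal.ofReal ((Set.Ici c).indicator (1 : ℝ → ℝ) (B s ω)
        + upcrossingsBefore c (c + 1) (fun k => B (unitGrid s M k)) (M + 1) ω) := by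
    rw [← ENNReal.ofReal_natCast]
    by_cases h : c ≤ B s ω <;> simp [h]
  simp_rw [hcast]
  have hsum : Integrable (fun ω => (Set.Ici c).indicator (1 : ℝ → ℝ) (B s ω)
      + (upcrossingsBefore c (c + 1) (fun k => B (unitGrid s M k)) (M + 1) ω : ℝ)) P :=
    hindInt.add hupInt
  rw [← ofReal_integral_eq_lintegral_ofReal hsum (.of_forall fun ω =>
      add_nonneg (Set.indicator_nonneg (fun _ _ => zero_le_one) _) (Nat.cast_nonneg _)),
    integral_add hindInt hupInt]
  refine ENNReal.ofReal_le_ofReal ?_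
  set v : ℝ≥0 := ⟨s + 1, by positivity⟩
  have hvs : (v : ℝ) = s + 1 := rfl
  have hv0 : v ≠ 0 := fun h => by
    have := congrArg NNReal.toReal h
    rw [hvs, NNReal.coe_zero] at this
    linarith
  set r : ℝ := √(s / (s + 1))
  have hr2 : r ^ 2 = s / (s + 1) := Real.sq_sqrt (by positivity)
  have hr0 : 0 ≤ r := Real.sqrt_nonneg _
  have hr1 : r ≤ 1 := Real.sqrt_le_one.2 ((div_le_one (by positivity)).2 (by linarith))
  have hlaw1 : HasLaw (B (s + 1)) (gaussianReal 0 v) P := hB.isPreBrownianReal.hasLaw_eval v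
  have hlaw0 : HasLaw (B s) ((gaussianReal 0 v).map (r * ·)) P := by
    convert! hB.isPreBrownianReal.hasLaw_eval ⟨s, hs⟩ using 1
    rw [gaussianReal_map_const_mul, mul_zero]
    congr 1
    ext
    simp only [NNReal.coe_mul, NNReal.coe_mk, hvs, hr2]
    field_simp
    rfl
  have hE1 : ∫ ω, (B (s + 1) ω - c)⁺ ∂P = ∫ x, (x - c)⁺ ∂gaussianReal 0 v :=
    hlaw1.integral_comp (f := fun x => (x - c)⁺) (by fun_prop)
  have hE0 : ∫ ω, (B s ω - c)⁺ ∂P = ∫ x, (r * x - c)⁺ ∂gaussianReal 0 v :=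
    (hlaw0.integral_comp (f := fun x => (x - c)⁺) (by fun_prop)).trans
      (integral_map (by fun_prop) (by fun_prop))
  have hEind : ∫ ω, (Set.Ici c).indicator (1 : ℝ → ℝ) (B s ω) ∂P
      = ∫ x, (Set.Ici c).indicator (1 : ℝ → ℝ) (r * x) ∂gaussianReal 0 v :=
    (hlaw0.integral_comp hone.aestronglyMeasurable).trans
      (integral_map (by fun_prop) hone.aestronglyMeasurable)
  have hi1 : Integrable (fun x => (x - c)⁺) (gaussianReal 0 v) := by
    simpa using integrable_posPart_mul_sub_gaussianReal v 1 c
  have hi0 := integrable_posPart_mul_sub_gaussianReal v r c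
  have hi10 : Integrable (fun x => (x - c)⁺ - (r * x - c)⁺) (gaussianReal 0 v) := hi1.sub hi0
  have hiind : Integrable (fun x => (Set.Ici c).indicator (1 : ℝ → ℝ) (r * x))
      (gaussianReal 0 v) :=
    Integrable.of_bound (hone.comp (by fun_prop : Measurable (r * ·))).aestronglyMeasurable 1
      (.of_forall fun x => by by_cases h : c ≤ r * x <;> simp [h])
  have hid : Integrable ((Set.Ici c).indicator id) (gaussianReal 0 v) :=
    ((memLp_id_gaussianReal 1).integrable le_rfl).indicator measurableSet_Ici
  have hmean : 0 ≤ ∫ x, (Set.Ici c).indicator id x ∂gaussianReal 0 v :=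
    integral_nonneg fun x => Set.indicator_nonneg (fun y (hy : c ≤ y) => hc.le.trans hy) x
  have hsub : 1 - r ≤ (s + 1)⁻¹ := by
    have : (s + 1)⁻¹ = 1 - r ^ 2 := by
      rw [hr2]
      field_simp
      ring
    nlinarith
  rw [hE1, hE0] at hup
  rw [hEind]
  calc _ ≤ ∫ x, (Set.Ici c).indicator (1 : ℝ → ℝ) (r * x) ∂gaussianReal 0 v
        + (∫ x, (x - c)⁺ ∂gaussianReal 0 v - ∫ x, (r * x - c)⁺ ∂gaussianReal 0 v) := by
        gcongr
    _ = ∫ x, ((Set.Ici c).indicator (1 : ℝ → ℝ) (r * x) + ((x - c)⁺ - (r * x - c)⁺))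
          ∂gaussianReal 0 v := by
        rw [integral_add hiind hi10, integral_sub hi1 hi0]
    _ ≤ ∫ x, (c⁻¹ + (1 - r)) * (Set.Ici c).indicator id x ∂gaussianReal 0 v :=
        integral_mono (hiind.add hi10) (hid.const_mul _)
          fun x => indicator_add_posPart_sub_le hc hr0 hr1
    _ = (c⁻¹ + (1 - r)) * ∫ x, (Set.Ici c).indicator id x ∂gaussianReal 0 v :=
        integral_const_mul _ _
    _ ≤ (c⁻¹ + (s + 1)⁻¹) * ∫ x, (Set.Ici c).indicator id x ∂gaussianReal 0 v := by
        gcongr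
    _ = _ := by rw [integral_Ici_gaussianReal hv0, hvs]

lemma gaussian_bound_le {u n : ℝ} (hu : 0 < u) (hn : 0 < n) :
    ((u * n + 1)⁻¹ + n⁻¹) * (n * ((√(2 * π * n))⁻¹ * exp (-(u * n + 1) ^ 2 / (2 * n))))
      ≤ 4 / (√(2 * π * n) * u) * exp (-u ^ 2 * n / 2) := by
  have hexp : exp (-(u * n + 1) ^ 2 / (2 * n)) ≤ exp (-u ^ 2 * n / 2) * exp (-u) := by
    rw [← exp_add, exp_le_exp, div_le_iff₀ (by positivity)]
    nlinarith
  have hfac : ((u * n + 1)⁻¹ + n⁻¹) * n * exp (-u) ≤ 4 / u := by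
    have h1 : ((u * n + 1)⁻¹ + n⁻¹) * n ≤ (u + 1) / u := by
      have : (u * n + 1)⁻¹ ≤ (u * n)⁻¹ := by gcongr; linarith
      calc _ ≤ ((u * n)⁻¹ + n⁻¹) * n := by gcongr
        _ = (u + 1) / u := by field_simp; ring
    have h2 : (u + 1) * exp (-u) ≤ 1 := by
      rw [exp_neg, ← div_eq_mul_inv, div_le_one (exp_pos _)]
      exact add_one_le_exp u
    calc _ ≤ (u + 1) / u * exp (-u) := by gcongr
      _ = (u + 1) * exp (-u) / u := by ring
      _ ≤ 4 / u := by gcongr; linarith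
  calc _ ≤ ((u * n + 1)⁻¹ + n⁻¹) * (n * ((√(2 * π * n))⁻¹
          * (exp (-u ^ 2 * n / 2) * exp (-u)))) := by gcongr
    _ = ((u * n + 1)⁻¹ + n⁻¹) * n * exp (-u) * ((√(2 * π * n))⁻¹ * exp (-u ^ 2 * n / 2)) := by
        ring
    _ ≤ 4 / u * ((√(2 * π * n))⁻¹ * exp (-u ^ 2 * n / 2)) := by gcongr
    _ = _ := by field_simp

/-- Expected number of upcrossing times in a unit interval: for a standard
Brownian motion from `0`, `γ ∈ (0,1)`, `η > 0` with `2η > γ`, and `A ≥ γ + η + 2`, for every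
integer `n ≥ 1`,
`𝔼[#{i ≥ 1 : T_i ∈ (n-1, n]}] ≤ 4 / (√(2πn) (γ+η)) · e^{-(γ+η)² n / 2}`. -/
theorem statement8 {Ω : Type} [MeasurableSpace Ω] (P : Measure Ω) [IsProbabilityMeasure P]
    (B : ℝ → Ω → ℝ) (hB : IsBMFrom Ω P B 0)
    (γ η A : ℝ) (hγ0 : 0 < γ) (hγ1 : γ < 1) (hη : 0 < η) (hηγ : γ < 2 * η)
    (hA : γ + η + 2 ≤ A) (n : ℕ) (hn : 1 ≤ n) :
    (∫⁻ ω, ∑' i : ℕ,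
        Set.indicator {ω' | ENNReal.ofReal ((n : ℝ) - 1) < (upTimes B γ η A (i + 1)).2 ω' ∧
            (upTimes B γ η A (i + 1)).2 ω' ≤ ENNReal.ofReal (n : ℝ)}
          (fun _ => (1 : ℝ≥0∞)) ω ∂P)
      ≤ ENNReal.ofReal (4 / (Real.sqrt (2 * Real.pi * n) * (γ + η))
          * Real.exp (-(γ + η) ^ 2 * n / 2)) := by
  have hu : 0 < γ + η := by positivity
  have hn0 : (1 : ℝ) ≤ n := by exact_mod_cast hn
  set s : ℝ := (n : ℝ) - 1 with hs
  have hs0 : 0 ≤ s := by linarith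
  have hs1 : s + 1 = n := by rw [hs]; ring
  set c : ℝ := (γ + η) * n + 1 with hc
  have hc0 : 0 < c := by positivity
  set g : ℕ → Ω → ℝ≥0∞ := fun M ω => (((if c ≤ B s ω then 1 else 0)
    + upcrossingsBefore c (c + 1) (fun k => B (unitGrid s M k)) (M + 1) ω : ℕ) : ℝ≥0∞) with hg
  have hgm (M : ℕ) : Measurable (g M) := by
    obtain ⟨𝒢, hmart⟩ := hB.exists_martingale_unitGrid hs0 M
    have h1 : Measurable fun ω => if c ≤ B s ω then 1 else 0 :=
      Measurable.ite (measurableSet_le measurable_const (hB.meas s)) measurable_const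
        measurable_const
    exact (measurable_from_top (f := fun k : ℕ => (k : ℝ≥0∞))).comp
      (h1.add (hmart.1.measurable_upcrossingsBefore (lt_add_one c)))
  have hpoint (ω : Ω) : ∑' i : ℕ,
      Set.indicator {ω' | ENNReal.ofReal s < (upTimes B γ η A (i + 1)).2 ω' ∧
          (upTimes B γ η A (i + 1)).2 ω' ≤ ENNReal.ofReal (n : ℝ)} (fun _ => (1 : ℝ≥0∞)) ω
        ≤ liminf (fun M => g M ω) atTop := by
    rw [ENNReal.tsum_eq_iSup_sum]
    refine iSup_le fun F => ?_
    set F' := F.filter fun i => ENNReal.ofReal s < (upTimes B γ η A (i + 1)).2 ω ∧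
      (upTimes B γ η A (i + 1)).2 ω ≤ ENNReal.ofReal (n : ℝ) with hF'
    have hcard : ∑ i ∈ F, Set.indicator {ω' | ENNReal.ofReal s < (upTimes B γ η A (i + 1)).2 ω' ∧
          (upTimes B γ η A (i + 1)).2 ω' ≤ ENNReal.ofReal (n : ℝ)} (fun _ => (1 : ℝ≥0∞)) ω
        = (F'.card : ℝ≥0∞) := by
      simp [hF', Set.indicator_apply, Finset.sum_boole]
    rw [hcard]
    have hfin {i : ℕ} (hi : i ∈ F') : (upTimes B γ η A (i + 1)).2 ω ≠ ∞ :=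
      ((Finset.mem_filter.1 hi).2.2.trans_lt ENNReal.ofReal_lt_top).ne
    have hlow {i : ℕ} (hi : i ∈ F') : s < ((upTimes B γ η A (i + 1)).2 ω).toReal :=
      (ENNReal.ofReal_lt_iff_lt_toReal hs0 (hfin hi)).1 (Finset.mem_filter.1 hi).2.1
    have hupp {i : ℕ} (hi : i ∈ F') : ((upTimes B γ η A (i + 1)).2 ω).toReal ≤ n :=
      ENNReal.toReal_le_of_le_ofReal (by positivity) (Finset.mem_filter.1 hi).2.2
    have hev := eventually_card_le_upcrossingsBefore (hB.cont ω) (s := s) (lt_add_one c)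
      (fun i => ((upTimes B γ η A (i + 1)).2 ω).toReal) F'
      (fun i hi => ⟨(hlow hi).le, (hupp hi).trans hs1.ge⟩)
      (fun i hi => by
        rw [apply_upTimes_snd (hB.cont ω) (hfin hi)]
        have := mul_lt_mul_of_pos_left (hlow hi) hu
        rw [hs] at this
        linarith)
      (fun i hi j hj hij => by
        have hle := upTimes_fst_le_snd (B := B) (γ := γ) (η := η) (A := A) (ω := ω) hij
        have hRfin := ne_top_of_le_ne_top (hfin hj) hle
        have hRj := ENNReal.toReal_mono (hfin hj) hle
        refine ⟨_, ⟨ENNReal.toReal_mono hRfin (upTimes_snd_le_fst i), hRj⟩, ?_⟩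
        rw [apply_upTimes_fst (hB.cont ω) hRfin]
        have h1 := mul_le_mul_of_nonneg_left (hRj.trans (hupp hj)) hγ0.le
        have h2 : 0 ≤ η * n := by positivity
        linarith)
    refine le_liminf_of_le (by isBoundedDefault) ?_
    filter_upwards [hev] with M hM
    exact Nat.cast_le.2 hM
  calc _ ≤ ∫⁻ ω, liminf (fun M => g M ω) atTop ∂P := lintegral_mono hpoint
    _ ≤ liminf (fun M => ∫⁻ ω, g M ω ∂P) atTop := lintegral_liminf_le hgm
    _ ≤ ENNReal.ofReal ((c⁻¹ + (s + 1)⁻¹)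
          * ((s + 1) * ((√(2 * π * (s + 1)))⁻¹ * exp (-c ^ 2 / (2 * (s + 1)))))) := by
        refine liminf_le_of_frequently_le' (Eventually.frequently ?_)
        filter_upwards [eventually_gt_atTop 0] with M hM
        exact hB.lintegral_upcrossingsBefore_le hs0 hc0 hM
    _ ≤ _ := by
        rw [hs1]
        exact ENNReal.ofReal_le_ofReal (gaussian_bound_le hu (by linarith))
end
end

section
/- (Planar Brownian motion: hitting the diagonal before the vertical strips.) Let $(B_s)_{s\ge 0}$ be a standard two-dimensional Brownian motion started at $(0,y)$, let $\Delta:=\{(x,x):x\in\mathbb{R}\}$, let $\mathcal{T}_\Delta$ be the hitting time of $\Delta$ and $\mathcal{T}_{\{-1,1\}\times\mathbb{R}}$ the hitting time of the set $\{-1,1\}\times\mathbb{R}$. There exists a constant $C>0$ such that for all $y$ with $0<|y|\le 1/2$, $\mathbb{P}_{(0,y)}\big[\mathcal{T}_\Delta>\mathcal{T}_{\{-1,1\}\times\mathbb{R}}\big]\le C|y|$. -/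
open MeasureTheory ProbabilityTheory Filter Real
open scoped ENNReal

noncomputable section

/-- A standard two-dimensional Brownian motion started at `z`: continuous sample paths,
`B 0 = z`, all finite linear combinations of the (recentered) coordinate marginals at
nonnegative times are centered Gaussian, the two coordinates have covariance
`𝔼[(B¹_s - z₁)(B¹_t - z₁)] = 𝔼[(B²_s - z₂)(B²_t - z₂)] = s ∧ t`, and the coordinates are
uncorrelated. -/
structure IsBM2From (Ω : Type) [MeasurableSpace Ω] (P : Measure Ω)
    (B : ℝ → Ω → ℝ × ℝ) (z : ℝ × ℝ) : Prop where
  meas : ∀ t, Measurable (B t)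
  cont : ∀ ω, Continuous fun t => B t ω
  start : ∀ ω, B 0 ω = z
  gaussian : ∀ (n : ℕ) (c d : Fin n → ℝ) (t : Fin n → ℝ), (∀ i, 0 ≤ t i) →
    ∃ v : NNReal, Measure.map
      (fun ω => ∑ i, (c i * ((B (t i) ω).1 - z.1) + d i * ((B (t i) ω).2 - z.2))) P
        = gaussianReal 0 v
  cov1 : ∀ s t : ℝ, 0 ≤ s → 0 ≤ t →
    (∫ ω, ((B s ω).1 - z.1) * ((B t ω).1 - z.1) ∂P) = min s t
  cov2 : ∀ s t : ℝ, 0 ≤ s → 0 ≤ t →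
    (∫ ω, ((B s ω).2 - z.2) * ((B t ω).2 - z.2) ∂P) = min s t
  cov12 : ∀ s t : ℝ, 0 ≤ s → 0 ≤ t →
    (∫ ω, ((B s ω).1 - z.1) * ((B t ω).2 - z.2) ∂P) = 0

/-- The hitting time `𝒯_A = inf {s ≥ 0 : B_s ∈ A}`, valued in `ℝ≥0∞` with the convention
`inf ∅ = ∞`. -/
def hitSetTime {Ω : Type} (B : ℝ → Ω → ℝ × ℝ) (A : Set (ℝ × ℝ)) (ω : Ω) : ℝ≥0∞ :=
  sInf {u : ℝ≥0∞ | ∃ s : ℝ, 0 ≤ s ∧ u = ENNReal.ofReal s ∧ B s ω ∈ A}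

/-- The diagonal `Δ = {(x,x) : x ∈ ℝ}`. -/
def diagLine : Set (ℝ × ℝ) := {p : ℝ × ℝ | p.1 = p.2}

/-- The set `{-1,1} × ℝ`. -/
def vertLines : Set (ℝ × ℝ) := {p : ℝ × ℝ | p.1 = -1 ∨ p.1 = 1}

theorem strongDual_pi_prod_apply {ι : Type*} [Fintype ι] [DecidableEq ι]
    (L : StrongDual ℝ (ι → ℝ × ℝ)) (x : ι → ℝ × ℝ) :
    L x = ∑ i, (L (Pi.single i (1, 0)) * (x i).1 + L (Pi.single i (0, 1)) * (x i).2) := by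
  have key : x = ∑ i, ((x i).1 • (Pi.single i ((1 : ℝ), (0 : ℝ)) : ι → ℝ × ℝ)
      + (x i).2 • (Pi.single i ((0 : ℝ), (1 : ℝ)) : ι → ℝ × ℝ)) := by
    funext j
    rw [Finset.sum_apply, Finset.sum_eq_single j]
    · simp
    · intro i _ hij
      simp [hij.symm]
    · simp
  conv_lhs => rw [key]
  rw [map_sum]
  simp only [map_add, map_smul, smul_eq_mul]
  exact Finset.sum_congr rfl fun i _ => by ring

namespace IsBM2From

variable {Ω : Type} [MeasurableSpace Ω] {P : Measure Ω}
  {B : ℝ → Ω → ℝ × ℝ} {z : ℝ × ℝ}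

/-- The marginals of a planar Brownian motion at finitely many times are jointly Gaussian. -/
theorem hasGaussianLaw (h : IsBM2From Ω P B z) {n : ℕ} (s : Fin n → ℝ) (hs : ∀ i, 0 ≤ s i) :
    HasGaussianLaw (fun ω i => B (s i) ω - z) P where
  isGaussian_map := by
    have hm : Measurable fun ω (i : Fin n) => B (s i) ω - z :=
      measurable_pi_lambda _ fun i => (h.meas _).sub_const z
    refine isGaussian_of_map_eq_gaussianReal fun L => ?_
    obtain ⟨v, hv⟩ := h.gaussian n (fun i => L (Pi.single i (1, 0)))
      (fun i => L (Pi.single i (0, 1))) s hs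
    refine ⟨0, v, ?_⟩
    rw [Measure.map_map L.continuous.measurable hm, ← hv]
    congr 1
    ext ω
    exact strongDual_pi_prod_apply L _

theorem memLp_fst (h : IsBM2From Ω P B z) {s : ℝ} (hs : 0 ≤ s) :
    MemLp (fun ω => (B s ω).1 - z.1) 2 P :=
  ((h.hasGaussianLaw (fun _ : Fin 1 => s) fun _ => hs).map_fun
    ((ContinuousLinearMap.fst ℝ ℝ ℝ).comp (ContinuousLinearMap.proj 0))).memLp_two

theorem memLp_snd (h : IsBM2From Ω P B z) {s : ℝ} (hs : 0 ≤ s) :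
    MemLp (fun ω => (B s ω).2 - z.2) 2 P :=
  ((h.hasGaussianLaw (fun _ : Fin 1 => s) fun _ => hs).map_fun
    ((ContinuousLinearMap.snd ℝ ℝ ℝ).comp (ContinuousLinearMap.proj 0))).memLp_two

theorem integral_linear (h : IsBM2From Ω P B z) {s : ℝ} (hs : 0 ≤ s) (c d : ℝ) :
    ∫ ω, (c * ((B s ω).1 - z.1) + d * ((B s ω).2 - z.2)) ∂P = 0 := by
  obtain ⟨v, hv⟩ := h.gaussian 1 (fun _ => c) (fun _ => d) (fun _ => s) fun _ => hs
  simp only [Fin.sum_univ_one] at hv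
  have hm : Measurable fun ω => c * ((B s ω).1 - z.1) + d * ((B s ω).2 - z.2) := by
    have := h.meas s
    fun_prop
  have := integral_id_gaussianReal (μ := 0) (v := v)
  rw [← hv] at this
  rwa [← integral_map (f := fun x => x) hm.aemeasurable measurable_id.aestronglyMeasurable]

theorem integral_fst (h : IsBM2From Ω P B z) {s : ℝ} (hs : 0 ≤ s) :
    ∫ ω, ((B s ω).1 - z.1) ∂P = 0 := by
  simpa using h.integral_linear hs 1 0

theorem integral_snd (h : IsBM2From Ω P B z) {s : ℝ} (hs : 0 ≤ s) :
    ∫ ω, ((B s ω).2 - z.2) ∂P = 0 := by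
  simpa using h.integral_linear hs 0 1

variable [IsProbabilityMeasure P]

theorem covariance_fst (h : IsBM2From Ω P B z) {s t : ℝ} (hs : 0 ≤ s) (ht : 0 ≤ t) :
    cov[fun ω => (B s ω).1 - z.1, fun ω => (B t ω).1 - z.1; P] = min s t := by
  rw [covariance_eq_sub (h.memLp_fst hs) (h.memLp_fst ht), h.integral_fst hs, zero_mul, sub_zero]
  exact h.cov1 s t hs ht

theorem covariance_snd (h : IsBM2From Ω P B z) {s t : ℝ} (hs : 0 ≤ s) (ht : 0 ≤ t) :
    cov[fun ω => (B s ω).2 - z.2, fun ω => (B t ω).2 - z.2; P] = min s t := by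
  rw [covariance_eq_sub (h.memLp_snd hs) (h.memLp_snd ht), h.integral_snd hs, zero_mul, sub_zero]
  exact h.cov2 s t hs ht

theorem covariance_fst_snd (h : IsBM2From Ω P B z) {s t : ℝ} (hs : 0 ≤ s) (ht : 0 ≤ t) :
    cov[fun ω => (B s ω).1 - z.1, fun ω => (B t ω).2 - z.2; P] = 0 := by
  rw [covariance_eq_sub (h.memLp_fst hs) (h.memLp_snd ht), h.integral_fst hs, zero_mul, sub_zero]
  exact h.cov12 s t hs ht

/-- Linear functionals of one marginal. -/
theorem covariance_linear (h : IsBM2From Ω P B z) {s t : ℝ} (hs : 0 ≤ s) (ht : 0 ≤ t)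
    (a b c d : ℝ) :
    cov[fun ω => a * ((B s ω).1 - z.1) + b * ((B s ω).2 - z.2),
      fun ω => c * ((B t ω).1 - z.1) + d * ((B t ω).2 - z.2); P] = (a * c + b * d) * min s t := by
  have X1 := (h.memLp_fst hs).const_mul a
  have Y1 := (h.memLp_snd hs).const_mul b
  have X2 := (h.memLp_fst ht).const_mul c
  have Y2 := (h.memLp_snd ht).const_mul d
  refine (covariance_add_left X1 Y1 (X2.add Y2)).trans ?_
  rw [covariance_add_right X1 X2 Y2, covariance_add_right Y1 X2 Y2]
  simp only [covariance_const_mul_left, covariance_const_mul_right]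
  rw [h.covariance_fst hs ht, h.covariance_snd hs ht, h.covariance_fst_snd hs ht,
    covariance_comm (fun ω => (B s ω).2 - z.2), h.covariance_fst_snd ht hs]
  ring

/-- An increment is independent of finitely many earlier positions. -/
theorem indepFun_increment (h : IsBM2From Ω P B z) {n : ℕ} (s : Fin n → ℝ) {u t : ℝ}
    (hs : ∀ i, 0 ≤ s i) (hsu : ∀ i, s i ≤ u) (hu : 0 ≤ u) (hut : u ≤ t) (α β : ℝ) :
    IndepFun (fun ω i => B (s i) ω - z)
      (fun ω => α * ((B t ω).1 - (B u ω).1) + β * ((B t ω).2 - (B u ω).2)) P := by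
  have ht := hu.trans hut
  have hjoint : HasGaussianLaw (fun ω => ((fun i => B (s i) ω - z : Fin n → ℝ × ℝ),
      α * ((B t ω).1 - (B u ω).1) + β * ((B t ω).2 - (B u ω).2))) P := by
    have hG := h.hasGaussianLaw (Fin.cons t (Fin.cons u s) : Fin (n + 2) → ℝ) (by
      intro i
      refine Fin.cases ht (fun i => ?_) i
      exact Fin.cases hu (fun i => hs i) i)
    let p : Fin (n + 2) → ((Fin (n + 2) → ℝ × ℝ) →L[ℝ] ℝ × ℝ) := fun i => ContinuousLinearMap.proj i
    let Δ := p 0 - p 1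
    have := hG.map_fun ((ContinuousLinearMap.pi fun i : Fin n => p i.succ.succ).prod
      (α • (ContinuousLinearMap.fst ℝ ℝ ℝ).comp Δ + β • (ContinuousLinearMap.snd ℝ ℝ ℝ).comp Δ))
    have e : (fun ω => ((fun i => B (s i) ω - z : Fin n → ℝ × ℝ),
        α * ((B t ω).1 - (B u ω).1) + β * ((B t ω).2 - (B u ω).2))) = fun ω =>
        ((ContinuousLinearMap.pi fun i : Fin n => p i.succ.succ).prod
          (α • (ContinuousLinearMap.fst ℝ ℝ ℝ).comp Δ + β • (ContinuousLinearMap.snd ℝ ℝ ℝ).comp Δ))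
          fun i => B ((Fin.cons t (Fin.cons u s) : Fin (n + 2) → ℝ) i) ω - z := by
      funext ω
      refine Prod.ext ?_ ?_
      · funext i
        simp [p]
      · simp only [ContinuousLinearMap.prod_apply, add_apply, smul_apply,
          ContinuousLinearMap.comp_apply, sub_apply, Δ, p, ContinuousLinearMap.proj_apply,
          ContinuousLinearMap.coe_fst', ContinuousLinearMap.coe_snd', smul_eq_mul, Fin.cons_zero,
          Fin.cons_one]
        simp
    rw [e]
    exact this
  refine hjoint.indepFun_of_covariance_strongDual fun L₁ L₂ => ?_
  have e1 : L₁ ∘ (fun ω i => B (s i) ω - z) = fun ω => ∑ i,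
      (L₁ (Pi.single i (1, 0)) * ((B (s i) ω).1 - z.1)
        + L₁ (Pi.single i (0, 1)) * ((B (s i) ω).2 - z.2)) := by
    ext ω
    exact strongDual_pi_prod_apply L₁ _
  have lin (r : ℝ) (hr : 0 ≤ r) (c d : ℝ) :
      MemLp (fun ω => c * ((B r ω).1 - z.1) + d * ((B r ω).2 - z.2)) 2 P :=
    ((h.memLp_fst hr).const_mul c).add ((h.memLp_snd hr).const_mul d)
  have e2 : L₂ ∘ (fun ω => α * ((B t ω).1 - (B u ω).1) + β * ((B t ω).2 - (B u ω).2))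
      = fun ω => L₂ 1 * ((fun ω => α * ((B t ω).1 - z.1) + β * ((B t ω).2 - z.2))
        - fun ω => α * ((B u ω).1 - z.1) + β * ((B u ω).2 - z.2)) ω := by
    ext ω
    have (x : ℝ) : L₂ x = L₂ 1 * x := by
      rw [mul_comm, ← smul_eq_mul, ← map_smul]
      simp
    simp only [Function.comp_apply, Pi.sub_apply]
    rw [this]
    ring
  rw [e1, e2, covariance_const_mul_right, covariance_fun_sum_left (fun i => lin _ (hs i) _ _)
    ((lin t ht α β).sub (lin u hu α β))]
  refine mul_eq_zero_of_right _ (Finset.sum_eq_zero fun i _ => ?_)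
  rw [covariance_sub_right (lin _ (hs i) _ _) (lin t ht α β) (lin u hu α β),
    h.covariance_linear (hs i) ht, h.covariance_linear (hs i) hu,
    min_eq_left (hsu i), min_eq_left ((hsu i).trans hut), sub_self]

/-- Linear functionals of an increment are centered Gaussian. -/
theorem map_increment (h : IsBM2From Ω P B z) {u t : ℝ} (hu : 0 ≤ u) (hut : u ≤ t) (α β : ℝ) :
    P.map (fun ω => α * ((B t ω).1 - (B u ω).1) + β * ((B t ω).2 - (B u ω).2))
      = gaussianReal 0 ((α ^ 2 + β ^ 2) * (t - u)).toNNReal := by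
  have ht := hu.trans hut
  obtain ⟨v, hv⟩ := h.gaussian 2 ![α, -α] ![β, -β] ![t, u] (by simp [Fin.forall_fin_two, ht, hu])
  have e : (fun ω => ∑ i, (![α, -α] i * ((B (![t, u] i) ω).1 - z.1)
      + ![β, -β] i * ((B (![t, u] i) ω).2 - z.2)))
      = fun ω => α * ((B t ω).1 - (B u ω).1) + β * ((B t ω).2 - (B u ω).2) := by
    ext ω
    simp only [Fin.sum_univ_two, Matrix.cons_val_zero, Matrix.cons_val_one]
    ring
  rw [e] at hv
  have lin (r : ℝ) (hr : 0 ≤ r) (c d : ℝ) :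
      MemLp (fun ω => c * ((B r ω).1 - z.1) + d * ((B r ω).2 - z.2)) 2 P :=
    ((h.memLp_fst hr).const_mul c).add ((h.memLp_snd hr).const_mul d)
  have hm : Measurable fun ω => α * ((B t ω).1 - (B u ω).1) + β * ((B t ω).2 - (B u ω).2) := by
    have := h.meas t
    have := h.meas u
    fun_prop
  have hvar := variance_id_gaussianReal (μ := 0) (v := v)
  rw [← hv, variance_map measurable_id.aemeasurable hm.aemeasurable] at hvar
  have e2 : id ∘ (fun ω => α * ((B t ω).1 - (B u ω).1) + β * ((B t ω).2 - (B u ω).2))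
      = (fun ω => α * ((B t ω).1 - z.1) + β * ((B t ω).2 - z.2))
        - fun ω => α * ((B u ω).1 - z.1) + β * ((B u ω).2 - z.2) := by
    ext ω
    simp only [Function.comp_apply, Pi.sub_apply, id]
    ring
  have lt := lin t ht α β
  have lu := lin u hu α β
  rw [e2, ← covariance_self (lt.sub lu).aemeasurable,
    covariance_sub_left lt lu (lt.sub lu), covariance_sub_right lt lt lu,
    covariance_sub_right lu lt lu, h.covariance_linear ht ht, h.covariance_linear ht hu,
    h.covariance_linear hu hu, h.covariance_linear hu ht, min_self, min_self,
    min_eq_right hut, min_eq_left hut] at hvar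
  rw [hv]
  congr 1
  rw [show (α ^ 2 + β ^ 2) * (t - u) = v by rw [← hvar]; ring, Real.toNNReal_coe]

end IsBM2From

/-- Integrating out an independent centered Gaussian shift in the argument of the sine. -/
theorem integral_mul_sin_add_of_indepFun {Ω E : Type*} [MeasurableSpace Ω] [MeasurableSpace E]
    {P : Measure Ω} [IsProbabilityMeasure P] {X : Ω → E} {Y : Ω → ℝ} (hX : Measurable X)
    (hY : Measurable Y) (hXY : IndepFun X Y P) {v : ℝ} (hv : 0 ≤ v)
    (hlaw : P.map Y = gaussianReal 0 v.toNNReal) {g θ : E → ℝ} (hg : Measurable g)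
    (hθ : Measurable θ) {C : ℝ} (hC : ∀ x, |g x| ≤ C) :
    ∫ ω, g (X ω) * sin (θ (X ω) + Y ω) ∂P = exp (-v / 2) * ∫ ω, g (X ω) * sin (θ (X ω)) ∂P := by
  have hchar : ∫ ω, Complex.exp (Y ω * Complex.I) ∂P = (exp (-v / 2) : ℝ) := by
    have := charFun_gaussianReal (μ := 0) (v := v.toNNReal) 1
    rw [← hlaw, charFun_apply_real, integral_map hY.aemeasurable
      (by fun_prop : Continuous fun x : ℝ =>
        Complex.exp ((1 : ℝ) * x * Complex.I)).aestronglyMeasurable]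
      at this
    simpa [hv, neg_div] using this
  have hint : Integrable (fun ω => Complex.exp (Y ω * Complex.I)) P := by
    refine Integrable.of_bound (C := 1) (by fun_prop) (ae_of_all _ fun ω => ?_)
    rw [Complex.norm_exp_ofReal_mul_I]
  have hcos : ∫ ω, cos (Y ω) ∂P = exp (-v / 2) := by
    have := (integral_re hint).trans (congrArg Complex.re hchar)
    rw [Complex.ofReal_re] at this
    simpa [Complex.exp_ofReal_mul_I_re] using this
  have hsin : ∫ ω, sin (Y ω) ∂P = 0 := by
    have := (integral_im hint).trans (congrArg Complex.im hchar)
    rw [Complex.ofReal_im] at this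
    simpa [Complex.exp_ofReal_mul_I_im] using this
  have hbound {a b c : ℝ} (ha : |a| ≤ C) (hb : |b| ≤ 1) (hc : |c| ≤ 1) : ‖a * b * c‖ ≤ C := by
    rw [Real.norm_eq_abs, abs_mul, abs_mul]
    have h1 : |a| * |b| ≤ C := by nlinarith [abs_nonneg a, abs_nonneg b]
    nlinarith [abs_nonneg c, mul_nonneg (abs_nonneg a) (abs_nonneg b)]
  have i1 : Integrable (fun ω => g (X ω) * sin (θ (X ω)) * cos (Y ω)) P :=
    Integrable.of_bound (C := C) (by fun_prop)
      (ae_of_all _ fun ω => hbound (hC _) (abs_sin_le_one _) (abs_cos_le_one _))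
  have i2 : Integrable (fun ω => g (X ω) * cos (θ (X ω)) * sin (Y ω)) P :=
    Integrable.of_bound (C := C) (by fun_prop)
      (ae_of_all _ fun ω => hbound (hC _) (abs_cos_le_one _) (abs_sin_le_one _))
  have e : ∀ ω, g (X ω) * sin (θ (X ω) + Y ω)
      = g (X ω) * sin (θ (X ω)) * cos (Y ω) + g (X ω) * cos (θ (X ω)) * sin (Y ω) := by
    intro ω
    rw [sin_add]
    ring
  simp_rw [e]
  rw [integral_add i1 i2,
    hXY.integral_fun_comp_mul_comp (f := fun x => g x * sin (θ x)) (g := cos) hX.aemeasurable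
      hY.aemeasurable (by fun_prop) (by fun_prop),
    hXY.integral_fun_comp_mul_comp (f := fun x => g x * cos (θ x)) (g := sin) hX.aemeasurable
      hY.aemeasurable (by fun_prop) (by fun_prop), hcos, hsin, mul_zero, add_zero, mul_comm]

open Classical in
/-- A sequence stopped at its first exit from `U`. -/
def exitStopped {E : Type*} (U : Set E) (p : ℕ → E) : ℕ → E
  | 0 => p 0
  | k + 1 => if exitStopped U p k ∈ U then p (k + 1) else exitStopped U p k

theorem exitStopped_cases {E : Type*} {U : Set E} {p : ℕ → E} (h0 : p 0 ∈ U) (k : ℕ) :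
    (exitStopped U p k = p k ∧ ∀ j ≤ k, p j ∈ U) ∨
      ∃ j < k, exitStopped U p k = p (j + 1) ∧ p (j + 1) ∉ U ∧ ∀ i ≤ j, p i ∈ U := by
  induction k with
  | zero =>
    refine Or.inl ⟨rfl, fun j hj => ?_⟩
    rwa [Nat.le_zero.mp hj]
  | succ k ih =>
    rcases ih with ⟨hk, hU⟩ | ⟨j, hj, hk, hjU, hU⟩
    · have e : exitStopped U p (k + 1) = p (k + 1) := by
        rw [exitStopped, if_pos (hk ▸ hU k le_rfl)]
      by_cases hmem : p (k + 1) ∈ U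
      · refine Or.inl ⟨e, fun j hj => ?_⟩
        rcases Nat.le_succ_iff.mp hj with hj | rfl
        · exact hU j hj
        · exact hmem
      · exact Or.inr ⟨k, k.lt_succ_self, e, hmem, hU⟩
    · refine Or.inr ⟨j, hj.trans k.lt_succ_self, ?_, hjU, hU⟩
      rw [exitStopped, if_neg (hk ▸ hjU), hk]

theorem exitStopped_mem_iff {E : Type*} {U : Set E} {p : ℕ → E} (h0 : p 0 ∈ U) (k : ℕ) :
    exitStopped U p k ∈ U ↔ ∀ j ≤ k, p j ∈ U := by
  rcases exitStopped_cases h0 k with ⟨hk, hU⟩ | ⟨j, hj, hk, hjU, hU⟩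
  · exact iff_of_true (hk ▸ hU k le_rfl) hU
  · exact iff_of_false (hk ▸ hjU) fun h => hjU (h _ hj)

theorem exitStopped_eq_of_mem {E : Type*} {U : Set E} {p : ℕ → E} (h0 : p 0 ∈ U) {k : ℕ}
    (hk : exitStopped U p k ∈ U) : exitStopped U p k = p k := by
  rcases exitStopped_cases h0 k with ⟨h, -⟩ | ⟨j, -, h, hjU, -⟩
  · exact h
  · exact absurd (h ▸ hk) hjU

theorem measurable_exitStopped {Ω E : Type*} [MeasurableSpace Ω] [MeasurableSpace E] {U : Set E}
    (hU : MeasurableSet U) {p : Ω → ℕ → E} (hp : ∀ k, Measurable fun ω => p ω k) (k : ℕ) :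
    Measurable fun ω => exitStopped U (p ω) k := by
  induction k with
  | zero => exact hp 0
  | succ k ih => exact Measurable.ite (ih hU) (hp _) ih

/-- The signed distance-like function to the diagonal. -/
def diagGap (σ : ℝ) (p : ℝ × ℝ) : ℝ := σ * (p.1 - p.2)

/-- The barrier: superharmonic on `exitRegion`, small near the diagonal. -/
def barrier (σ : ℝ) (p : ℝ × ℝ) : ℝ :=
  1 - cos (p.1 / 2) + 2 * (sin (diagGap σ p / 2 + 1) - sin 1)

/-- The region adjacent to the diagonal from which the walk is stopped. -/
def exitRegion (σ : ℝ) : Set (ℝ × ℝ) :=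
  {p | 0 < diagGap σ p ∧ diagGap σ p < 1 ∧ |p.1| < 1 / 2}

theorem continuous_diagGap (σ : ℝ) : Continuous (diagGap σ) := by
  unfold diagGap
  fun_prop

theorem continuous_barrier (σ : ℝ) : Continuous (barrier σ) := by
  have := continuous_diagGap σ
  unfold barrier
  fun_prop

theorem measurableSet_exitRegion (σ : ℝ) : MeasurableSet (exitRegion σ) := by
  have := continuous_diagGap σ
  exact ((isOpen_lt continuous_const this).inter ((isOpen_lt this continuous_const).inter
    (isOpen_lt continuous_fst.abs continuous_const))).measurableSet

theorem neg_four_le_barrier (σ : ℝ) (p : ℝ × ℝ) : -4 ≤ barrier σ p := by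
  unfold barrier
  linarith [cos_le_one (p.1 / 2), neg_one_le_sin (diagGap σ p / 2 + 1), sin_le_one 1]

theorem barrier_le_six (σ : ℝ) (p : ℝ × ℝ) : barrier σ p ≤ 6 := by
  unfold barrier
  linarith [neg_one_le_cos (p.1 / 2), sin_le_one (diagGap σ p / 2 + 1), neg_one_le_sin 1]

theorem abs_barrier_le (σ : ℝ) (p : ℝ × ℝ) : |barrier σ p| ≤ 6 :=
  abs_le.mpr ⟨by linarith [neg_four_le_barrier σ p], barrier_le_six σ p⟩

theorem sin_one_le_sin {θ : ℝ} (h1 : 1 ≤ θ) (h2 : θ ≤ 7 / 4) : sin 1 ≤ sin θ := by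
  rw [← cos_pi_div_two_sub 1, ← cos_pi_div_two_sub θ, ← cos_abs (π / 2 - θ)]
  have := pi_gt_d2
  have := pi_lt_d2
  exact cos_le_cos_of_nonneg_of_le_pi (abs_nonneg _) (by linarith)
    (abs_le.mpr ⟨by linarith, by linarith⟩)

theorem neg_le_barrier {σ η : ℝ} {p : ℝ × ℝ} (hη : 0 ≤ η) (h1 : -η ≤ diagGap σ p)
    (h2 : diagGap σ p ≤ 3 / 2) : -η ≤ barrier σ p := by
  have hc := cos_le_one (p.1 / 2)
  unfold barrier
  rcases le_or_gt 0 (diagGap σ p) with h | h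
  · linarith [sin_one_le_sin (θ := diagGap σ p / 2 + 1) (by linarith) (by linarith)]
  · have := abs_sin_sub_sin_le (diagGap σ p / 2 + 1) 1
    rw [add_sub_cancel_right, abs_of_neg (by linarith : diagGap σ p / 2 < 0)] at this
    linarith [(abs_le.mp this).1]

/-- A lower bound for the barrier off the diagonal on the boundary of `exitRegion`. -/
def barrierMin : ℝ := min (1 - cos (1 / 4)) (2 * (cos (1 / 5) - sin 1))

theorem barrierMin_pos : 0 < barrierMin := by
  have := pi_gt_d2
  have := pi_lt_d2
  refine lt_min ?_ ?_
  · have := cos_lt_cos_of_nonneg_of_le_pi (x := 0) (y := 1 / 4) le_rfl (by linarith) (by norm_num)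
    rw [cos_zero] at this
    linarith
  · have := cos_lt_cos_of_nonneg_of_le_pi (x := 1 / 5) (y := π / 2 - 1) (by norm_num)
      (by linarith) (by linarith)
    rw [cos_pi_div_two_sub] at this
    linarith

theorem barrierMin_le_barrier {σ : ℝ} {p : ℝ × ℝ} (h1 : 0 ≤ diagGap σ p)
    (h2 : diagGap σ p ≤ 3 / 2) (hp : |p.1| ≤ 1) (h : 1 ≤ diagGap σ p ∨ 1 / 2 ≤ |p.1|) :
    barrierMin ≤ barrier σ p := by
  have := pi_gt_d2
  have := pi_lt_d2
  unfold barrier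
  rcases h with h | h
  · refine (min_le_right _ _).trans ?_
    have : cos (1 / 5) ≤ sin (diagGap σ p / 2 + 1) := by
      rw [← cos_pi_div_two_sub (_ + 1), ← cos_abs (π / 2 - _)]
      exact cos_le_cos_of_nonneg_of_le_pi (abs_nonneg _) (by linarith)
        (abs_le.mpr ⟨by linarith, by linarith⟩)
    linarith [cos_le_one (p.1 / 2)]
  · refine (min_le_left _ _).trans ?_
    have : cos (p.1 / 2) ≤ cos (1 / 4) := by
      rw [← cos_abs (p.1 / 2), abs_div, abs_of_pos (by norm_num : (0 : ℝ) < 2)]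
      exact cos_le_cos_of_nonneg_of_le_pi (by norm_num) (by linarith) (by linarith)
    linarith [sin_one_le_sin (θ := diagGap σ p / 2 + 1) (by linarith) (by linarith)]

/-- The stopped barrier along a sequence with small increments. -/
theorem barrier_exitStopped_lower {σ η : ℝ} {p : ℕ → ℝ × ℝ} {K : ℕ} (h0 : p 0 ∈ exitRegion σ)
    (hη : 0 ≤ η) (hη2 : η ≤ 1 / 2)
    (hinc : ∀ j < K, |(p (j + 1)).1 - (p j).1| ≤ η ∧
      |diagGap σ (p (j + 1)) - diagGap σ (p j)| ≤ η) :
    -η ≤ barrier σ (exitStopped (exitRegion σ) p K) ∧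
      ∀ m ≤ K, 1 / 2 ≤ |(p m).1| → (∀ j ≤ m, 0 < diagGap σ (p j)) →
        barrierMin ≤ barrier σ (exitStopped (exitRegion σ) p K) := by
  rcases exitStopped_cases h0 K with ⟨hK, hU⟩ | ⟨j, hj, hK, hjU, hU⟩
  · refine ⟨?_, fun m hm hpm => absurd hpm (not_le.mpr (hU m hm).2.2)⟩
    obtain ⟨a, b, -⟩ := hU K le_rfl
    rw [hK]
    exact neg_le_barrier hη (by linarith) (by linarith)
  · obtain ⟨a, b, c⟩ := hU j le_rfl
    obtain ⟨i1, i2⟩ := hinc j hj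
    rw [abs_le] at i1 i2
    rw [abs_lt] at c
    rw [hK]
    refine ⟨neg_le_barrier hη (by linarith) (by linarith), fun m hm hpm hpos => ?_⟩
    have hjm : j + 1 ≤ m := by
      by_contra! hlt
      exact not_lt.mpr hpm (hU m (Nat.lt_succ_iff.mp hlt)).2.2
    have hgap := hpos _ hjm
    refine barrierMin_le_barrier hgap.le (by linarith) (abs_le.mpr ⟨by linarith, by linarith⟩) ?_
    by_contra! hnot
    exact hjU ⟨hgap, hnot.1, hnot.2⟩

namespace IsBM2From

variable {Ω : Type} [MeasurableSpace Ω] {P : Measure Ω} [IsProbabilityMeasure P]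
  {B : ℝ → Ω → ℝ × ℝ} {z : ℝ × ℝ}

theorem integral_mul_sin_add_increment (h : IsBM2From Ω P B z) {n : ℕ} (s : Fin n → ℝ) {u t : ℝ}
    (hs : ∀ i, 0 ≤ s i) (hsu : ∀ i, s i ≤ u) (hu : 0 ≤ u) (hut : u ≤ t) (α β : ℝ)
    {g θ : (Fin n → ℝ × ℝ) → ℝ} (hg : Measurable g) (hθ : Measurable θ) {C : ℝ}
    (hC : ∀ x, |g x| ≤ C) :
    ∫ ω, g (fun i => B (s i) ω - z) * sin (θ (fun i => B (s i) ω - z)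
        + (α * ((B t ω).1 - (B u ω).1) + β * ((B t ω).2 - (B u ω).2))) ∂P
      = exp (-((α ^ 2 + β ^ 2) * (t - u)) / 2)
        * ∫ ω, g (fun i => B (s i) ω - z) * sin (θ (fun i => B (s i) ω - z)) ∂P := by
  refine integral_mul_sin_add_of_indepFun
    (measurable_pi_lambda _ fun i => (h.meas _).sub_const z) ?_
    (h.indepFun_increment s hs hsu hu hut α β)
    (mul_nonneg (by positivity) (sub_nonneg.mpr hut)) (h.map_increment hu hut α β) hg hθ hC
  have := h.meas t
  have := h.meas u
  fun_prop

/-- The barrier is superharmonic for one Gaussian step started from `exitRegion`. -/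
theorem integral_indicator_barrier_step (h : IsBM2From Ω P B z) {σ : ℝ} (hσ : σ ^ 2 = 1) {n : ℕ}
    (s : Fin (n + 1) → ℝ) {t : ℝ} (hs : ∀ i, 0 ≤ s i) (hsu : ∀ i, s i ≤ s (Fin.last n))
    (hut : s (Fin.last n) ≤ t) {A : Set (Fin (n + 1) → ℝ × ℝ)} (hA : MeasurableSet A)
    (hAU : ∀ x ∈ A, x (Fin.last n) + z ∈ exitRegion σ) :
    ∫ ω, A.indicator 1 (fun i => B (s i) ω - z)
      * (barrier σ (B t ω) - barrier σ (B (s (Fin.last n)) ω)) ∂P ≤ 0 := by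
  set u := s (Fin.last n) with hu
  set V : Ω → Fin (n + 1) → ℝ × ℝ := fun ω i => B (s i) ω - z with hV
  set g : (Fin (n + 1) → ℝ × ℝ) → ℝ := A.indicator 1 with hgdef
  have hVm : Measurable V := measurable_pi_lambda _ fun i => (h.meas _).sub_const z
  have hg : Measurable g := measurable_one.indicator hA
  have hg01 : ∀ x, 0 ≤ g x ∧ g x ≤ 1 := fun x => by
    by_cases hx : x ∈ A <;> simp [g, hx]
  have hC : ∀ x, |g x| ≤ 1 := fun x => abs_le.mpr ⟨by linarith [(hg01 x).1], (hg01 x).2⟩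
  let θ₁ : (Fin (n + 1) → ℝ × ℝ) → ℝ := fun x => (x (Fin.last n) + z).1 / 2 + π / 2
  let θ₂ : (Fin (n + 1) → ℝ × ℝ) → ℝ := fun x => diagGap σ (x (Fin.last n) + z) / 2 + 1
  have hθ₁ : Measurable θ₁ := by fun_prop
  have hθ₂ : Measurable θ₂ := by
    have := (continuous_diagGap σ).measurable
    fun_prop
  have hVl (ω : Ω) : V ω (Fin.last n) + z = B u ω := by simp [hV, hu]
  have E₁ := h.integral_mul_sin_add_increment s hs hsu (hs _) hut (1 / 2) 0 hg hθ₁ hC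
  have E₂ := h.integral_mul_sin_add_increment s hs hsu (hs _) hut (σ / 2) (-(σ / 2)) hg hθ₂ hC
  have s₁ (ω : Ω) : sin (θ₁ (V ω)
      + (1 / 2 * ((B t ω).1 - (B u ω).1) + 0 * ((B t ω).2 - (B u ω).2))) = cos ((B t ω).1 / 2) := by
    rw [← sin_add_pi_div_two]
    congr 1
    simp only [θ₁, hVl]
    ring
  have s₂ (ω : Ω) : sin (θ₂ (V ω) + (σ / 2 * ((B t ω).1 - (B u ω).1)
      + -(σ / 2) * ((B t ω).2 - (B u ω).2))) = sin (diagGap σ (B t ω) / 2 + 1) := by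
    congr 1
    simp only [θ₂, hVl, diagGap]
    ring
  have s₃ (ω : Ω) : sin (θ₁ (V ω)) = cos ((B u ω).1 / 2) := by
    simp only [θ₁, hVl, sin_add_pi_div_two]
  have s₄ (ω : Ω) : sin (θ₂ (V ω)) = sin (diagGap σ (B u ω) / 2 + 1) := by
    simp only [θ₂, hVl]
  change ∫ ω, g (V ω) * sin (θ₁ (V ω)
      + (1 / 2 * ((B t ω).1 - (B u ω).1) + 0 * ((B t ω).2 - (B u ω).2))) ∂P
    = _ * ∫ ω, g (V ω) * sin (θ₁ (V ω)) ∂P at E₁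
  change ∫ ω, g (V ω) * sin (θ₂ (V ω) + (σ / 2 * ((B t ω).1 - (B u ω).1)
      + -(σ / 2) * ((B t ω).2 - (B u ω).2))) ∂P
    = _ * ∫ ω, g (V ω) * sin (θ₂ (V ω)) ∂P at E₂
  simp_rw [s₁, s₃] at E₁
  simp_rw [s₂, s₄] at E₂
  change ∫ ω, g (V ω) * (barrier σ (B t ω) - barrier σ (B u ω)) ∂P ≤ 0
  have mB (r : ℝ) : Measurable (B r) := h.meas r
  have mG : Measurable (diagGap σ) := (continuous_diagGap σ).measurable
  have hb {a b : ℝ} (ha : |a| ≤ 1) (hb : |b| ≤ 1) : ‖a * b‖ ≤ 1 := by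
    rw [Real.norm_eq_abs, abs_mul]
    exact mul_le_one₀ ha (abs_nonneg _) hb
  have iC (r : ℝ) : Integrable (fun ω => g (V ω) * cos ((B r ω).1 / 2)) P :=
    Integrable.of_bound (C := 1) (by fun_prop) (ae_of_all _ fun ω => hb (hC _) (abs_cos_le_one _))
  have iS (r : ℝ) : Integrable (fun ω => g (V ω) * sin (diagGap σ (B r ω) / 2 + 1)) P :=
    Integrable.of_bound (C := 1) (by fun_prop) (ae_of_all _ fun ω => hb (hC _) (abs_sin_le_one _))
  set e₁ := exp (-(((1 / 2) ^ 2 + 0 ^ 2) * (t - u)) / 2) with he₁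
  set e₂ := exp (-(((σ / 2) ^ 2 + (-(σ / 2)) ^ 2) * (t - u)) / 2) with he₂
  have hle1 : e₁ ≤ 1 := by
    rw [he₁, exp_le_one_iff]
    nlinarith
  have hle2 : e₂ ≤ e₁ := by
    rw [he₁, he₂, exp_le_exp]
    have : (σ / 2) ^ 2 + (-(σ / 2)) ^ 2 = 1 / 2 := by nlinarith
    rw [this]
    nlinarith
  have expand : ∫ ω, g (V ω) * (barrier σ (B t ω) - barrier σ (B u ω)) ∂P
      = ∫ ω, g (V ω) * ((1 - e₁) * cos ((B u ω).1 / 2)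
        - 2 * (1 - e₂) * sin (diagGap σ (B u ω) / 2 + 1)) ∂P := by
    have l : ∀ ω, g (V ω) * (barrier σ (B t ω) - barrier σ (B u ω))
        = (g (V ω) * cos ((B u ω).1 / 2) - g (V ω) * cos ((B t ω).1 / 2))
          + 2 * (g (V ω) * sin (diagGap σ (B t ω) / 2 + 1)
            - g (V ω) * sin (diagGap σ (B u ω) / 2 + 1)) := by
      intro ω
      unfold barrier
      ring
    have r : ∀ ω, g (V ω) * ((1 - e₁) * cos ((B u ω).1 / 2)
        - 2 * (1 - e₂) * sin (diagGap σ (B u ω) / 2 + 1))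
        = (1 - e₁) * (g (V ω) * cos ((B u ω).1 / 2))
          - 2 * (1 - e₂) * (g (V ω) * sin (diagGap σ (B u ω) / 2 + 1)) := by
      intro ω
      ring
    simp_rw [l, r]
    have iCC : Integrable (fun ω => g (V ω) * cos ((B u ω).1 / 2)
      - g (V ω) * cos ((B t ω).1 / 2)) P := (iC u).sub (iC t)
    have iSS : Integrable (fun ω => 2 * (g (V ω) * sin (diagGap σ (B t ω) / 2 + 1)
      - g (V ω) * sin (diagGap σ (B u ω) / 2 + 1))) P := ((iS t).sub (iS u)).const_mul 2
    rw [integral_add iCC iSS,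
      integral_sub (iC u) (iC t), integral_const_mul, integral_sub (iS t) (iS u),
      integral_sub ((iC u).const_mul _) ((iS u).const_mul _), integral_const_mul,
      integral_const_mul, E₁, E₂]
    ring
  rw [expand]
  refine integral_nonpos fun ω => ?_
  by_cases hω : V ω ∈ A
  · have hmem := hAU _ hω
    rw [hVl] at hmem
    obtain ⟨a, b, -⟩ := hmem
    have hsin : 1 / 2 ≤ sin (diagGap σ (B u ω) / 2 + 1) := by
      have hpi := pi_gt_d2
      have h4 := pi_lt_four
      have := mul_le_sin (x := diagGap σ (B u ω) / 2 + 1) (by linarith) (by linarith)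
      refine le_trans ?_ this
      rw [div_mul_eq_mul_div, le_div_iff₀ pi_pos]
      linarith
    have : g (V ω) = 1 := by simp [g, hω]
    simp only [this, one_mul, Pi.zero_apply]
    nlinarith [cos_le_one ((B u ω).1 / 2)]
  · simp [g, hω]

theorem integrable_barrier_comp {f : Ω → ℝ × ℝ} (hf : Measurable f) (σ : ℝ) :
    Integrable (fun ω => barrier σ (f ω)) P :=
  Integrable.of_bound (C := 6) ((continuous_barrier σ).measurable.comp hf).aestronglyMeasurable
    (ae_of_all _ fun _ => abs_barrier_le _ _)

theorem integral_barrier_exitStopped_le (h : IsBM2From Ω P B z) {σ δ : ℝ} (hσ : σ ^ 2 = 1)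
    (hδ : 0 ≤ δ) (hz : z ∈ exitRegion σ) (k : ℕ) :
    ∫ ω, barrier σ (exitStopped (exitRegion σ) (fun j => B (j * δ) ω) k) ∂P ≤ barrier σ z := by
  have h0 (ω : Ω) : (fun j : ℕ => B (j * δ) ω) 0 ∈ exitRegion σ := by simpa [h.start] using hz
  have hmeas (k : ℕ) : Measurable fun ω => exitStopped (exitRegion σ) (fun j => B (j * δ) ω) k :=
    measurable_exitStopped (measurableSet_exitRegion σ) (fun j => h.meas _) k
  induction k with
  | zero => simp [exitStopped, h.start]
  | succ k ih =>
    refine le_trans ?_ ih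
    rw [← sub_nonpos, ← integral_sub (integrable_barrier_comp (hmeas _) σ)
      (integrable_barrier_comp (hmeas _) σ)]
    let A : Set (Fin (k + 1) → ℝ × ℝ) := {x | ∀ i, x i + z ∈ exitRegion σ}
    have hA : MeasurableSet A := by
      simp only [A, Set.ofPred_forall]
      refine MeasurableSet.iInter fun i => ?_
      have hm : Measurable fun x : Fin (k + 1) → ℝ × ℝ => x i + z := by fun_prop
      exact hm (measurableSet_exitRegion σ)
    have step := h.integral_indicator_barrier_step hσ (fun i : Fin (k + 1) => (i : ℕ) * δ)
      (t := (k + 1 : ℕ) * δ) (fun i => by positivity)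
      (fun i => mul_le_mul_of_nonneg_right (by exact_mod_cast Fin.le_last i) hδ)
      (mul_le_mul_of_nonneg_right (by simp) hδ) hA (fun x hx => hx _)
    refine le_of_eq_of_le (integral_congr_ae (ae_of_all _ fun ω => ?_)) step
    have iff : (fun i : Fin (k + 1) => B ((i : ℕ) * δ) ω - z) ∈ A
        ↔ exitStopped (exitRegion σ) (fun j => B (j * δ) ω) k ∈ exitRegion σ := by
      rw [exitStopped_mem_iff (h0 ω)]
      constructor
      · intro hx j hj
        simpa using hx ⟨j, Nat.lt_succ_of_le hj⟩
      · intro hx i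
        simpa using hx i (Nat.le_of_lt_succ i.2)
    by_cases hmem : exitStopped (exitRegion σ) (fun j => B (j * δ) ω) k ∈ exitRegion σ
    · have heq := exitStopped_eq_of_mem (h0 ω) hmem
      simp only [exitStopped, if_pos hmem, Set.indicator_of_mem (iff.mpr hmem), heq]
      simp
    · simp only [exitStopped, if_neg hmem, Set.indicator_of_notMem (mt iff.mp hmem)]
      simp

end IsBM2From

/-- Fine discretizations of a continuous path, stopped on exiting `exitRegion`. -/
theorem eventually_barrier_exitStopped_lower {σ η : ℝ} {b : ℝ → ℝ × ℝ} (hb : Continuous b)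
    (h0 : b 0 ∈ exitRegion σ) (N : ℕ) (hη : 0 < η) (hη2 : η ≤ 1 / 2) :
    ∀ᶠ n : ℕ in atTop,
      -η ≤ barrier σ (exitStopped (exitRegion σ) (fun j => b (j * (1 / ((n : ℝ) + 1))))
        (N * (n + 1))) ∧
      ((∃ s : ℝ, 0 ≤ s ∧ s ≤ N ∧ |(b s).1| = 1 ∧
          ∀ u : ℝ, 0 ≤ u → u ≤ s → 0 < diagGap σ (b u)) →
        barrierMin ≤ barrier σ (exitStopped (exitRegion σ)
          (fun j => b (j * (1 / ((n : ℝ) + 1)))) (N * (n + 1)))) := by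
  have hcont : Continuous fun t => ((b t).1, diagGap σ (b t)) :=
    (continuous_fst.comp hb).prodMk ((continuous_diagGap σ).comp hb)
  have huc := (isCompact_Icc (a := (0 : ℝ)) (b := N)).uniformContinuousOn_of_continuous
    hcont.continuousOn
  obtain ⟨ε, hε, H⟩ := Metric.uniformContinuousOn_iff.mp huc η hη
  have H' : ∀ x ∈ Set.Icc (0 : ℝ) N, ∀ y ∈ Set.Icc (0 : ℝ) N, |x - y| < ε →
      |(b x).1 - (b y).1| ≤ η ∧ |diagGap σ (b x) - diagGap σ (b y)| ≤ η := by
    intro x hx y hy hxy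
    have := H x hx y hy hxy
    rw [Prod.dist_eq, max_lt_iff, Real.dist_eq, Real.dist_eq] at this
    exact ⟨this.1.le, this.2.le⟩
  filter_upwards [(tendsto_one_div_add_atTop_nhds_zero_nat (𝕜 := ℝ)).eventually_lt_const hε]
    with n hn
  set δ : ℝ := 1 / ((n : ℝ) + 1) with hδ
  have hn1 : (0 : ℝ) < (n : ℝ) + 1 := by positivity
  have hδ0 : 0 < δ := by positivity
  have hδ1 : ((n : ℝ) + 1) * δ = 1 := by rw [hδ]; field_simp
  have hgrid : ∀ j ≤ N * (n + 1), (j : ℝ) * δ ∈ Set.Icc (0 : ℝ) N := by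
    intro j hj
    refine ⟨by positivity, ?_⟩
    calc (j : ℝ) * δ ≤ (N * (n + 1) : ℕ) * δ := by gcongr
      _ = N := by push_cast; rw [mul_assoc, hδ1, mul_one]
  obtain ⟨low, high⟩ := barrier_exitStopped_lower (σ := σ) (p := fun j : ℕ => b (j * δ))
    (K := N * (n + 1)) (by simpa using h0) hη.le hη2 (by
      intro j hj
      refine H' _ (hgrid _ hj) _ (hgrid _ hj.le) ?_
      push_cast
      rwa [add_mul, one_mul, add_sub_cancel_left, abs_of_pos hδ0])
  refine ⟨low, ?_⟩
  rintro ⟨s, hs0, hsN, hs1, hpos⟩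
  have hm1 : ((⌊s * (n + 1)⌋₊ : ℕ) : ℝ) * δ ≤ s := by
    calc ((⌊s * (n + 1)⌋₊ : ℕ) : ℝ) * δ ≤ s * (n + 1) * δ := by
          gcongr
          exact Nat.floor_le (by positivity)
      _ = s := by rw [mul_assoc, hδ1, mul_one]
  have hm2 : s < ((⌊s * (n + 1)⌋₊ : ℕ) : ℝ) * δ + δ := by
    calc s = s * (n + 1) * δ := by rw [mul_assoc, hδ1, mul_one]
      _ < ((⌊s * (n + 1)⌋₊ : ℕ) + 1) * δ := by
          gcongr
          exact Nat.lt_floor_add_one _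
      _ = _ := by ring
  have hmK : ⌊s * (n + 1)⌋₊ ≤ N * (n + 1) := by
    refine Nat.floor_le_of_le ?_
    push_cast
    gcongr
  refine high _ hmK ?_ fun j hj => hpos _ (by positivity) (le_trans ?_ hm1)
  · have := (H' _ (hgrid _ hmK) s ⟨hs0, hsN⟩ (abs_lt.mpr ⟨by linarith, by linarith⟩)).1
    have h2 := abs_sub_abs_le_abs_sub (b s).1 (b ((⌊s * (n + 1)⌋₊ : ℕ) * δ)).1
    rw [abs_sub_comm] at this
    linarith
  · gcongr

namespace IsBM2From

variable {Ω : Type} [MeasurableSpace Ω] {P : Measure Ω} [IsProbabilityMeasure P]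
  {B : ℝ → Ω → ℝ × ℝ} {z : ℝ × ℝ}

/-- The probability of reaching the vertical lines by time `N` while staying off the diagonal. -/
theorem measure_reach_le (h : IsBM2From Ω P B z) {σ : ℝ} (hσ : σ ^ 2 = 1)
    (hz : z ∈ exitRegion σ) (hz0 : 0 ≤ barrier σ z) (N : ℕ) :
    P {ω | ∃ s : ℝ, 0 ≤ s ∧ s ≤ N ∧ |(B s ω).1| = 1 ∧
        ∀ u : ℝ, 0 ≤ u → u ≤ s → 0 < diagGap σ (B u ω)}
      ≤ ENNReal.ofReal (barrier σ z / barrierMin) := by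
  set Z : ℕ → Ω → ℝ := fun n ω => barrier σ (exitStopped (exitRegion σ)
    (fun j => B (j * (1 / ((n : ℝ) + 1))) ω) (N * (n + 1))) with hZ
  have hSm (n : ℕ) : Measurable fun ω => exitStopped (exitRegion σ)
      (fun j => B (j * (1 / ((n : ℝ) + 1))) ω) (N * (n + 1)) :=
    measurable_exitStopped (measurableSet_exitRegion σ) (fun j => h.meas _) _
  have hZm (n : ℕ) : Measurable (Z n) := (continuous_barrier σ).measurable.comp (hSm n)
  have hZi (n : ℕ) : Integrable (Z n) P := integrable_barrier_comp (hSm n) σ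
  have hZle (n : ℕ) : ∫ ω, Z n ω ∂P ≤ barrier σ z :=
    h.integral_barrier_exitStopped_le hσ (by positivity) hz _
  have hlow (ω : Ω) {η : ℝ} (hη : 0 < η) (hη2 : η ≤ 1 / 2) :=
    eventually_barrier_exitStopped_lower (h.cont ω) (by simpa only [h.start] using hz) N hη hη2
  set W : ℕ → Ω → ℝ≥0∞ := fun n ω => ENNReal.ofReal (Z n ω + 4) with hW
  have hWm (n : ℕ) : Measurable (W n) := ((hZm n).add_const 4).ennreal_ofReal
  set Y : Ω → ℝ≥0∞ := fun ω => liminf (fun n => W n ω) atTop with hY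
  have hYm : Measurable Y := Measurable.liminf hWm
  have hYint : ∫⁻ ω, Y ω ∂P ≤ ENNReal.ofReal (barrier σ z) + 4 := by
    refine (lintegral_liminf_le hWm).trans ?_
    refine liminf_le_of_le (by isBoundedDefault) fun b hb => ?_
    obtain ⟨n, hn⟩ := hb.exists
    refine hn.trans ?_
    have hi : Integrable (fun ω => Z n ω + 4) P := (hZi n).add (integrable_const 4)
    have hpos : ∀ ω, 0 ≤ Z n ω + 4 := fun ω => by linarith [neg_four_le_barrier σ (exitStopped
      (exitRegion σ) (fun j => B (j * (1 / ((n : ℝ) + 1))) ω) (N * (n + 1)))]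
    rw [(ofReal_integral_eq_lintegral_ofReal hi (ae_of_all _ hpos)).symm,
      integral_add (hZi n) (integrable_const 4)]
    rw [show (4 : ℝ≥0∞) = ENNReal.ofReal 4 by simp, ← ENNReal.ofReal_add hz0 (by norm_num)]
    refine ENNReal.ofReal_le_ofReal ?_
    simpa using hZle n
  have hY4 (ω : Ω) : 4 ≤ Y ω := by
    refine le_of_forall_lt_imp_le_of_dense fun a ha => ?_
    have ha4 : a.toReal < 4 := by
      simpa using (ENNReal.toReal_lt_toReal ha.ne_top (by simp)).mpr ha
    refine le_liminf_of_le (by isBoundedDefault) ?_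
    filter_upwards [hlow ω (η := min (1 / 2) (4 - a.toReal))
      (lt_min (by norm_num) (by linarith)) (min_le_left _ _)] with n hn
    rw [← ENNReal.ofReal_toReal ha.ne_top]
    refine ENNReal.ofReal_le_ofReal ?_
    have := min_le_right (1 / 2) (4 - a.toReal)
    linarith [hn.1]
  have hYc : {ω | ∃ s : ℝ, 0 ≤ s ∧ s ≤ N ∧ |(B s ω).1| = 1 ∧
      ∀ u : ℝ, 0 ≤ u → u ≤ s → 0 < diagGap σ (B u ω)}
      ⊆ {ω | ENNReal.ofReal barrierMin + 4 ≤ Y ω} := by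
    intro ω hω
    change ENNReal.ofReal barrierMin + 4 ≤ liminf (fun n => W n ω) atTop
    refine le_liminf_of_le (by isBoundedDefault) ?_
    filter_upwards [hlow ω (η := 1 / 2) (by norm_num) le_rfl] with n hn
    rw [show (4 : ℝ≥0∞) = ENNReal.ofReal 4 by simp,
      ← ENNReal.ofReal_add barrierMin_pos.le (by norm_num)]
    exact ENNReal.ofReal_le_ofReal (by linarith [hn.2 hω])
  have hset : MeasurableSet {ω | ENNReal.ofReal barrierMin + 4 ≤ Y ω} :=
    measurableSet_le measurable_const hYm
  refine (measure_mono hYc).trans ?_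
  have key : ENNReal.ofReal barrierMin * P {ω | ENNReal.ofReal barrierMin + 4 ≤ Y ω} + 4
      ≤ ENNReal.ofReal (barrier σ z) + 4 := by
    refine le_trans ?_ hYint
    calc ENNReal.ofReal barrierMin * P {ω | ENNReal.ofReal barrierMin + 4 ≤ Y ω} + 4
        = ∫⁻ ω, ({ω | ENNReal.ofReal barrierMin + 4 ≤ Y ω}.indicator
            (fun _ => ENNReal.ofReal barrierMin) ω + 4) ∂P := by
          rw [lintegral_add_right _ measurable_const, lintegral_indicator_const hset]
          simp
      _ ≤ ∫⁻ ω, Y ω ∂P := by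
          refine lintegral_mono fun ω => ?_
          by_cases hω : ω ∈ {ω | ENNReal.ofReal barrierMin + 4 ≤ Y ω}
          · rw [Set.indicator_of_mem hω]
            exact hω
          · rw [Set.indicator_of_notMem hω, zero_add]
            exact hY4 ω
  have key2 := (ENNReal.add_le_add_iff_right (by simp)).mp key
  rw [ENNReal.ofReal_div_of_pos barrierMin_pos]
  refine (ENNReal.le_div_iff_mul_le (Or.inl ?_) (Or.inl ENNReal.ofReal_ne_top)).mpr ?_
  · exact (ENNReal.ofReal_pos.mpr barrierMin_pos).ne'
  · rwa [mul_comm]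

theorem measure_hitSetTime_lt_le (h : IsBM2From Ω P B z) {σ : ℝ} (hσ : σ ^ 2 = 1)
    (hz : z ∈ exitRegion σ) (hz0 : 0 ≤ barrier σ z) :
    P {ω | hitSetTime B vertLines ω < hitSetTime B diagLine ω}
      ≤ ENNReal.ofReal (barrier σ z / barrierMin) := by
  let E : ℕ → Set Ω := fun N => {ω | ∃ s : ℝ, 0 ≤ s ∧ s ≤ N ∧ |(B s ω).1| = 1 ∧
    ∀ u : ℝ, 0 ≤ u → u ≤ s → 0 < diagGap σ (B u ω)}
  have hE : Monotone E := by
    rintro M N hMN ω ⟨s, h0, hs, hr⟩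
    exact ⟨s, h0, hs.trans (by exact_mod_cast hMN), hr⟩
  have hsub : {ω | hitSetTime B vertLines ω < hitSetTime B diagLine ω} ⊆ ⋃ N, E N := by
    intro ω hω
    obtain ⟨_, ⟨s, hs, rfl, hv⟩, hlt⟩ := sInf_lt_iff.mp (show hitSetTime B vertLines ω < _ from hω)
    obtain ⟨N, hN⟩ := exists_nat_ge s
    refine Set.mem_iUnion.mpr ⟨N, s, hs, hN, ?_, fun u hu hus => ?_⟩
    · rcases hv with hv | hv <;> simp [hv]
    · by_contra! hneg
      have hcont : ContinuousOn (fun t => diagGap σ (B t ω)) (Set.Icc 0 u) :=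
        ((continuous_diagGap σ).comp (h.cont ω)).continuousOn
      have h0 : (0 : ℝ) ≤ diagGap σ (B 0 ω) := by simpa only [h.start] using hz.1.le
      obtain ⟨r, ⟨hr0, hru⟩, hr⟩ := intermediate_value_Icc' hu hcont (Set.mem_Icc.mpr ⟨hneg, h0⟩)
      have hσ0 : σ ≠ 0 := by
        rintro rfl
        norm_num at hσ
      have hmem : B r ω ∈ diagLine :=
        sub_eq_zero.mp ((mul_eq_zero.mp hr).resolve_left hσ0)
      have hhit : hitSetTime B diagLine ω ≤ ENNReal.ofReal r := sInf_le ⟨r, hr0, rfl, hmem⟩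
      exact absurd hlt (not_lt.mpr (hhit.trans (ENNReal.ofReal_le_ofReal (hru.trans hus))))
  refine (measure_mono hsub).trans ?_
  rw [hE.measure_iUnion]
  exact iSup_le fun N => h.measure_reach_le hσ hz hz0 N

end IsBM2From

/-- Planar Brownian motion: hitting the diagonal before the vertical strips:
there is `C > 0` such that for all `y` with `0 < |y| ≤ 1/2` and every standard planar
Brownian motion started at `(0,y)`,
`ℙ[𝒯_Δ > 𝒯_{{-1,1}×ℝ}] ≤ C |y|`. -/
theorem statement13 :
    ∃ C : ℝ, 0 < C ∧ ∀ y : ℝ, 0 < |y| → |y| ≤ 1 / 2 →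
      ∀ (Ω : Type) [MeasurableSpace Ω] (P : Measure Ω) [IsProbabilityMeasure P]
        (B : ℝ → Ω → ℝ × ℝ), IsBM2From Ω P B (0, y) →
        P {ω | hitSetTime B vertLines ω < hitSetTime B diagLine ω}
          ≤ ENNReal.ofReal (C * |y|) := by
  refine ⟨1 / barrierMin, one_div_pos.mpr barrierMin_pos, ?_⟩
  intro y hy0 hy Ω _ P _ B h
  obtain ⟨σ, hσ, hgap⟩ : ∃ σ : ℝ, σ ^ 2 = 1 ∧ diagGap σ (0, y) = |y| := by
    rcases le_total 0 y with hy' | hy'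
    · exact ⟨-1, by norm_num, by simp [diagGap, abs_of_nonneg hy']⟩
    · exact ⟨1, by norm_num, by simp [diagGap, abs_of_nonpos hy']⟩
  have hmem : ((0, y) : ℝ × ℝ) ∈ exitRegion σ := by
    refine ⟨hgap ▸ hy0, by linarith, by norm_num⟩
  have hnonneg : 0 ≤ barrier σ (0, y) := by
    simpa using neg_le_barrier (σ := σ) (p := (0, y)) le_rfl (by linarith) (by linarith)
  have hle : barrier σ (0, y) ≤ |y| := by
    have := (abs_le.mp (abs_sin_sub_sin_le (|y| / 2 + 1) 1)).2
    rw [add_sub_cancel_right, abs_of_pos (by linarith : 0 < |y| / 2)] at this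
    simp only [barrier, hgap, zero_div, cos_zero]
    linarith
  refine (h.measure_hitSetTime_lt_le hσ hmem hnonneg).trans (ENNReal.ofReal_le_ofReal ?_)
  rw [one_div_mul_eq_div]
  gcongr
  exact barrierMin_pos.le
end
end
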